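/- arXiv:math-ph/0404030 — 4 statements merged into one kernel-verified Lean document; each statement's English description precedes it below -/
import Mathlib

section
/- A unital order isomorphism α between the self-adjoint parts of two C*-algebras preserves the Jordan product: α((ab+ba)/2) = (α(a)α(b)+α(b)α(a))/2 for all self-adjoint a, b. -/
open Polynomial in
lemma kad_bern {B : Type*} [CStarAlgebra B] [PartialOrder B] [StarOrderedRing B]
    (ψ : ℝ[X] →ₗ[ℝ] B) (h1 : ψ 1 = 1)
    (hpos : ∀ p : ℝ[X], (∀ x : ℝ, 0 ≤ x → x ≤ 1 → 0 ≤ p.eval x) → 0 ≤ ψ p) (n : ℕ) :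
    0 ≤ (n : ℝ) • (ψ (X ^ 2) - ψ X * ψ X) + (ψ X - ψ X * ψ X) := by
  set t := ψ X with ht
  have htsa : star t = t := by
    have : 0 ≤ t := hpos X (by intro x hx _; simpa using hx)
    exact (IsSelfAdjoint.of_nonneg this)
  set N : ℕ := n + 1 with hN
  let e : ℕ → B := fun k => ψ (bernsteinPolynomial ℝ N k)
  have he : ∀ k, 0 ≤ e k := by
    intro k
    apply hpos
    intro x h0 h1
    have : 0 ≤ 1 - x := by linarith
    simp only [bernsteinPolynomial, eval_mul, eval_pow, eval_natCast, eval_X, eval_sub, eval_one]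
    positivity
  have hs0 : ∑ k ∈ Finset.range (N + 1), e k = 1 := by
    rw [← h1, ← bernsteinPolynomial.sum ℝ N, map_sum]
  have hs1 : ∑ k ∈ Finset.range (N + 1), (k : ℝ) • e k = (N : ℝ) • t := by
    have := congrArg ψ (bernsteinPolynomial.sum_smul ℝ N)
    simp only [map_sum, map_nsmul] at this
    simp only [Nat.cast_smul_eq_nsmul]
    exact this
  have hs2 : ∑ k ∈ Finset.range (N + 1), ((k : ℝ) * k) • e k
      = ((N : ℝ) * n) • ψ (X ^ 2) + (N : ℝ) • t := by
    have := congrArg ψ (bernsteinPolynomial.sum_mul_smul ℝ N)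
    rw [map_sum, map_nsmul] at this
    rw [← hs1]
    have h3 : ((N : ℝ) * n) • ψ (X ^ 2) = (N * (N - 1)) • ψ (X ^ 2) := by
      rw [← Nat.cast_smul_eq_nsmul ℝ]; simp [hN]
    rw [h3, ← this, ← Finset.sum_add_distrib]
    refine Finset.sum_congr rfl fun k _ => ?_
    rw [map_nsmul, ← Nat.cast_smul_eq_nsmul ℝ, ← add_smul]
    congr 1
    rcases k with _ | k
    · simp
    · push_cast [Nat.add_sub_cancel]; ring
  have hsum : 0 ≤ ∑ k ∈ Finset.range (N + 1),
      star ((k : ℝ) • (1 : B) - (N : ℝ) • t) * e k * ((k : ℝ) • (1 : B) - (N : ℝ) • t) :=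
    Finset.sum_nonneg fun k _ => star_left_conjugate_nonneg (he k) _
  have hexp : ∑ k ∈ Finset.range (N + 1),
      star ((k : ℝ) • (1 : B) - (N : ℝ) • t) * e k * ((k : ℝ) • (1 : B) - (N : ℝ) • t)
      = ((N : ℝ) * n) • ψ (X ^ 2) + (N : ℝ) • t - ((N : ℝ) * N) • (t * t) := by
    have hk : ∀ k ∈ Finset.range (N + 1),
        star ((k : ℝ) • (1 : B) - (N : ℝ) • t) * e k * ((k : ℝ) • (1 : B) - (N : ℝ) • t)
        = ((k : ℝ) * k) • e k - (N : ℝ) • (t * ((k : ℝ) • e k)) - (N : ℝ) • (((k : ℝ) • e k) * t)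
          + ((N : ℝ) * N) • (t * e k * t) := by
      intro k _
      simp only [star_sub, star_smul, star_one, star_trivial, htsa, sub_mul, mul_sub,
        smul_mul_assoc, mul_smul_comm, one_mul, mul_one, smul_sub]
      module
    rw [Finset.sum_congr rfl hk, Finset.sum_add_distrib, Finset.sum_sub_distrib,
      Finset.sum_sub_distrib, ← Finset.smul_sum, ← Finset.smul_sum, ← Finset.smul_sum,
      ← Finset.mul_sum, ← Finset.sum_mul, ← Finset.sum_mul, ← Finset.mul_sum, hs0, hs1, hs2]
    simp only [smul_mul_assoc, mul_smul_comm, mul_one]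
    module
  rw [hexp] at hsum
  have hNp : (0 : ℝ) < N := by simp [hN]; positivity
  have := smul_nonneg (inv_nonneg.2 hNp.le) hsum
  convert this using 1
  have : ((N : ℝ) * n) • ψ (X ^ 2) + (N : ℝ) • t - ((N : ℝ) * N) • (t * t)
    = (N : ℝ) • ((n : ℝ) • (ψ (X ^ 2) - t * t) + (t - t * t)) := by
    have : (N : ℝ) = n + 1 := by simp [hN]
    rw [this]; module
  rw [this, inv_smul_smul₀ hNp.ne']

open Polynomial in
lemma kad_bern_lim {B : Type*} [CStarAlgebra B] [PartialOrder B] [StarOrderedRing B]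
    (ψ : ℝ[X] →ₗ[ℝ] B) (h1 : ψ 1 = 1)
    (hpos : ∀ p : ℝ[X], (∀ x : ℝ, 0 ≤ x → x ≤ 1 → 0 ≤ p.eval x) → 0 ≤ ψ p) :
    ψ X * ψ X ≤ ψ (X ^ 2) := by
  rw [← sub_nonneg]
  set s := ψ (X ^ 2) - ψ X * ψ X with hs
  set r := ψ X - ψ X * ψ X with hr
  have h : ∀ n : ℕ, 0 ≤ s + ((n : ℝ) + 1)⁻¹ • r := by
    intro n
    have h0 := kad_bern ψ h1 hpos (n + 1)
    rw [← hs, ← hr] at h0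
    have hp : (0 : ℝ) < (n : ℝ) + 1 := by positivity
    have := smul_nonneg (inv_nonneg.2 hp.le) h0
    push_cast at this
    rwa [smul_add, inv_smul_smul₀ hp.ne'] at this
  have ht : Filter.Tendsto (fun n : ℕ => s + ((n : ℝ) + 1)⁻¹ • r) Filter.atTop
      (nhds (s + (0 : ℝ) • r)) := by
    refine tendsto_const_nhds.add (Filter.Tendsto.smul_const ?_ r)
    simpa [one_div] using tendsto_one_div_add_atTop_nhds_zero_nat (𝕜 := ℝ)
  rw [zero_smul, add_zero] at ht
  exact ge_of_tendsto' ht h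

open Polynomial in
lemma kad_schwarz {A B : Type*} [CStarAlgebra A] [PartialOrder A] [StarOrderedRing A]
    [CStarAlgebra B] [PartialOrder B] [StarOrderedRing B]
    (φ : selfAdjoint A →ₗ[ℝ] selfAdjoint B)
    (hone : (φ (1 : selfAdjoint A) : B) = 1)
    (hpos : ∀ a : selfAdjoint A, (0 : A) ≤ a → (0 : B) ≤ φ a)
    (a d : selfAdjoint A) (hd : (d : A) = (a : A) * a) :
    (φ a : B) * φ a ≤ φ d := by
  have hsa : IsSelfAdjoint (a : A) := a.2
  have hcfc : ∀ p : ℝ[X], IsSelfAdjoint (aeval (a : A) p) := by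
    intro p
    rw [← cfc_polynomial p (a : A) hsa]
    exact cfc_predicate _ _
  let Φ : ℝ[X] →ₗ[ℝ] B :=
    { toFun := fun p => (φ ⟨aeval (a : A) p, hcfc p⟩ : B)
      map_add' := by
        intro p q
        rw [← AddSubgroup.coe_add, ← map_add]
        congr 2
        ext
        simp
      map_smul' := by
        intro c p
        rw [RingHom.id_apply, ← selfAdjoint.val_smul, ← map_smul]
        congr 2
        ext
        simp }
  have hΦ : ∀ (p : ℝ[X]) (b : selfAdjoint A), aeval (a : A) p = b → Φ p = φ b := by
    intro p b h
    change (φ ⟨aeval (a : A) p, hcfc p⟩ : B) = φ b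
    congr 2
    ext
    exact h
  have hΦ1 : Φ 1 = 1 := by rw [hΦ 1 1 (by simp), hone]
  have hΦX : Φ X = φ a := hΦ X a (by simp)
  have hΦX2 : Φ (X ^ 2) = φ d := hΦ (X ^ 2) d (by simp [hd, sq])
  set M : ℝ := ‖(a : A)‖ + 1 with hM
  have hM0 : 0 < M := by positivity
  have hspec : ∀ x ∈ spectrum ℝ (a : A), -M ≤ x ∧ x ≤ M := by
    intro x hx
    have : Nontrivial A := by
      by_contra hn
      rw [not_nontrivial_iff_subsingleton] at hn
      simp [spectrum.of_subsingleton] at hx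
    have h := spectrum.norm_le_norm_of_mem hx
    rw [Real.norm_eq_abs, abs_le] at h
    constructor <;> linarith [h.1, h.2]
  let c : ℝ := (2 * M)⁻¹
  have hc : 0 < c := by positivity
  let L : ℝ[X] := C c * X + C (1 / 2)
  let ψ : ℝ[X] →ₗ[ℝ] B := Φ.comp (aeval L : ℝ[X] →ₐ[ℝ] ℝ[X]).toLinearMap
  have hψ : ∀ p, ψ p = Φ (aeval L p) := fun p => rfl
  have key := kad_bern_lim ψ (by rw [hψ, map_one, hΦ1]) (by
    intro p hp
    apply hpos
    change 0 ≤ aeval (a : A) (aeval L p)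
    rw [← cfc_polynomial _ (a : A) hsa]
    apply cfc_nonneg
    intro x hx
    obtain ⟨h1, h2⟩ := hspec x hx
    have : (aeval L p).eval x = p.eval (c * x + 1 / 2) := by
      rw [← comp_eq_aeval, eval_comp]
      simp [L]
    rw [this]
    have hcM : c * M = 1 / 2 := by simp only [c]; field_simp
    apply hp <;> nlinarith)
  have e1 : ψ X = c • (φ a : B) + (1 / 2 : ℝ) • (1 : B) := by
    rw [hψ, aeval_X, ← hΦX, ← hΦ1, ← map_smul, ← map_smul, ← map_add]
    congr 1
    simp only [L, smul_eq_C_mul]; ring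
  have e2 : ψ (X ^ 2) = (c * c) • (φ d : B) + c • (φ a : B) + (1 / 4 : ℝ) • (1 : B) := by
    rw [hψ, map_pow, aeval_X, ← hΦX, ← hΦX2, ← hΦ1, ← map_smul, ← map_smul, ← map_smul,
      ← map_add, ← map_add]
    congr 1
    have h2 : (C (1 / 2 : ℝ)) * 2 = (1 : ℝ[X]) := by
      rw [show (2 : ℝ[X]) = C 2 from rfl, ← C_mul]; norm_num
    have h4 : (C (1 / 4 : ℝ) : ℝ[X]) = C (1 / 2) * C (1 / 2) := by rw [← C_mul]; norm_num
    simp only [L, smul_eq_C_mul, h4, C_mul]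
    linear_combination (C c * X) * h2
  rw [e1, e2, ← sub_nonneg] at key
  have e3 : (c * c) • (φ d : B) + c • (φ a : B) + (1 / 4 : ℝ) • (1 : B)
      - (c • (φ a : B) + (1 / 2 : ℝ) • (1 : B)) * (c • (φ a : B) + (1 / 2 : ℝ) • (1 : B))
      = (c * c) • ((φ d : B) - (φ a : B) * φ a) := by
    simp only [add_mul, mul_add, smul_mul_assoc, mul_smul_comm, one_mul, mul_one]
    module
  rw [e3] at key
  have hcc : 0 < c * c := by positivity
  have := smul_nonneg (inv_nonneg.2 hcc.le) key
  rw [inv_smul_smul₀ hcc.ne', sub_nonneg] at this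
  exact this

lemma kad_sq {A B : Type*} [CStarAlgebra A] [PartialOrder A] [StarOrderedRing A]
    [CStarAlgebra B] [PartialOrder B] [StarOrderedRing B]
    (α : selfAdjoint A →ₗ[ℝ] selfAdjoint B)
    (hbij : Function.Bijective α)
    (hone : (α (1 : selfAdjoint A) : B) = 1)
    (horder : ∀ a : selfAdjoint A, (0 : A) ≤ a ↔ (0 : B) ≤ α a)
    (a d : selfAdjoint A) (hd : (d : A) = (a : A) * a) :
    (α d : B) = (α a : B) * α a := by
  refine le_antisymm ?_ (kad_schwarz α hone (fun a => (horder a).1) a d hd)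
  let β := (LinearEquiv.ofBijective α hbij).symm
  have hβ : ∀ x, α (β x) = x := fun x => (LinearEquiv.ofBijective α hbij).apply_symm_apply x
  have hβ' : ∀ x, β (α x) = x := fun x => (LinearEquiv.ofBijective α hbij).symm_apply_apply x
  have hα1 : α 1 = 1 := by ext; simpa using hone
  have hsa : IsSelfAdjoint ((α a : B) * α a) := by
    have : star (α a : B) = α a := (α a).2
    simp [IsSelfAdjoint, this]
  have h := kad_schwarz (β : selfAdjoint B →ₗ[ℝ] selfAdjoint A)
    (by
      have : β 1 = 1 := by rw [← hα1, hβ']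
      simp [this])
    (by
      intro b hb
      rw [horder]
      simpa [hβ] using hb) (α a) ⟨_, hsa⟩ rfl
  simp only [LinearEquiv.coe_coe, hβ'] at h
  rw [← hd, ← sub_nonneg, ← AddSubgroup.coe_sub, horder, map_sub, hβ, AddSubgroup.coe_sub,
    sub_nonneg] at h
  exact h

lemma kad_main {A B : Type*} [CStarAlgebra A] [PartialOrder A] [StarOrderedRing A]
    [CStarAlgebra B] [PartialOrder B] [StarOrderedRing B]
    (α : selfAdjoint A →ₗ[ℝ] selfAdjoint B)
    (hbij : Function.Bijective α)
    (hone : (α (1 : selfAdjoint A) : B) = 1)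
    (horder : ∀ a : selfAdjoint A, (0 : A) ≤ a ↔ (0 : B) ≤ α a) :
    ∀ a b c : selfAdjoint A, (c : A) = (2⁻¹ : ℝ) • ((a : A) * b + (b : A) * a) →
      (α c : B) = (2⁻¹ : ℝ) • ((α a : B) * α b + (α b : B) * α a) := by
  intro a b c hc
  have hsq : ∀ x : selfAdjoint A, IsSelfAdjoint ((x : A) * x) := by
    intro x
    have : star (x : A) = x := x.2
    simp [IsSelfAdjoint, this]
  have ha := kad_sq α hbij hone horder a ⟨_, hsq a⟩ rfl
  have hb := kad_sq α hbij hone horder b ⟨_, hsq b⟩ rfl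
  have hab := kad_sq α hbij hone horder (a + b)
    ((⟨_, hsq a⟩ : selfAdjoint A) + ⟨_, hsq b⟩ + (2 : ℝ) • c) (by
      simp only [AddSubgroup.coe_add, selfAdjoint.val_smul, hc, add_mul, mul_add]
      module)
  simp only [map_add, map_smul, AddSubgroup.coe_add, selfAdjoint.val_smul, ha, hb,
    add_mul, mul_add] at hab
  have : (2 : ℝ) • (α c : B) = (α a : B) * α b + (α b : B) * α a := by
    have h2 := sub_eq_zero.2 hab
    rw [← sub_eq_zero, ← h2]
    abel
  rw [← this, inv_smul_smul₀ two_ne_zero]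


/-- Kadison: a unital linear order isomorphism between the self-adjoint parts of two
unital C*-algebras preserves the Jordan product. -/
theorem kadison_jordan
    {A B : Type*}
    [NormedRing A] [StarRing A] [CStarRing A] [NormedAlgebra ℂ A]
    [StarModule ℂ A] [CompleteSpace A] [PartialOrder A] [StarOrderedRing A]
    [NormedRing B] [StarRing B] [CStarRing B] [NormedAlgebra ℂ B]
    [StarModule ℂ B] [CompleteSpace B] [PartialOrder B] [StarOrderedRing B]
    (α : selfAdjoint A →ₗ[ℝ] selfAdjoint B)
    (hbij : Function.Bijective α)
    (hone : (α (1 : selfAdjoint A) : B) = 1)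
    (horder : ∀ a : selfAdjoint A, (0 : A) ≤ a ↔ (0 : B) ≤ α a) :
    ∀ a b c : selfAdjoint A, (c : A) = (2⁻¹ : ℝ) • ((a : A) * b + (b : A) * a) →
      (α c : B) = (2⁻¹ : ℝ) • ((α a : B) * α b + (α b : B) * α a) := by
  letI : CStarAlgebra A := {}
  letI : CStarAlgebra B := {}
  exact kad_main α hbij hone horder
end

section
/- (Arveson extension) Let A be a unital C*-algebra, N ⊆ A a closed self-adjoint subspace containing the identity (an operator system), and τ : N → B(H) a completely positive map. Then τ extends to a completely positive map τ̃ : A → B(H) with τ̃|_N = τ. -/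
/-- An element of a star ring is positive if it is of the form `b* b`. -/
def IsPosElem {R : Type*} [NonUnitalSemiring R] [StarRing R] (a : R) : Prop :=
  ∃ b : R, a = star b * b

/-- A linear map between star algebras is completely positive if all of its matrix
amplifications map positive matrices to positive matrices. -/
def IsCPmap {A B : Type*} [NonUnitalSemiring A] [StarRing A] [Module ℂ A]
    [NonUnitalSemiring B] [StarRing B] [Module ℂ B] (τ : A →ₗ[ℂ] B) : Prop :=
  ∀ (n : ℕ) (a : Matrix (Fin n) (Fin n) A), IsPosElem a → IsPosElem (a.map τ)

/-- Complete positivity for a map defined on a subspace `N` of a C*-algebra `A`: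
matrices with entries in `N` that are positive in `Matrix n n A` are mapped to
positive matrices. -/
def IsCPon {A B : Type*} [Ring A] [StarRing A] [Module ℂ A]
    [NonUnitalSemiring B] [StarRing B] [Module ℂ B]
    (N : Submodule ℂ A) (τ : N →ₗ[ℂ] B) : Prop :=
  ∀ (n : ℕ) (a : Matrix (Fin n) (Fin n) N),
    IsPosElem (a.map (fun x => (x : A))) → IsPosElem (a.map τ)


section ArvesonAux

set_option linter.unusedSectionVars false

open scoped ComplexConjugate ComplexOrder

lemma exists_sqrt_aux {A : Type*} [NormedRing A] [StarRing A] [CStarRing A] [NormedAlgebra ℂ A]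
    [StarModule ℂ A] [CompleteSpace A] (a : A) :
    ∃ c : A, ((‖a‖ ^ 2 : ℝ) : ℂ) • (1 : A) - star a * a = star c * c := by
  let : CStarAlgebra A := { }
  let := CStarAlgebra.spectralOrder A
  have := CStarAlgebra.spectralOrderedRing A
  have h := CStarAlgebra.star_mul_le_algebraMap_norm_sq (a := a)
  rw [← sub_nonneg, CStarAlgebra.nonneg_iff_eq_star_mul_self] at h
  obtain ⟨c, hc⟩ := h
  refine ⟨c, ?_⟩
  rw [← hc, Algebra.algebraMap_eq_smul_one]
  congr 1

lemma op_sqrt_aux {K : Type*} [NormedAddCommGroup K] [InnerProductSpace ℂ K] [CompleteSpace K]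
    (S : K →L[ℂ] K) (h : ∀ x, (0 : ℂ) ≤ inner ℂ x (S x)) : ∃ R : K →L[ℂ] K, S = star R * R := by
  have hS : 0 ≤ S := by
    rw [ContinuousLinearMap.nonneg_iff_isPositive, ContinuousLinearMap.isPositive_iff_complex]
    intro x
    have h0 := h x
    have h1 : inner ℂ (S x) x = inner ℂ x (S x) := by
      rw [← inner_conj_symm (S x) x]
      rw [Complex.nonneg_iff] at h0
      apply Complex.ext
      · rw [Complex.conj_re]
      · rw [Complex.conj_im, ← h0.2, neg_zero]
    rw [h1]
    rw [Complex.nonneg_iff] at h0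
    exact ⟨Complex.ext (by simp) (by simpa using h0.2), h0.1⟩
  exact CStarAlgebra.nonneg_iff_eq_star_mul_self.mp hS

lemma posElem_of_forms_abs {H : Type*} [NormedAddCommGroup H] [InnerProductSpace ℂ H]
    [CompleteSpace H] {K : Type*} [NormedAddCommGroup K] [InnerProductSpace ℂ K] [CompleteSpace K]
    (n : ℕ) (T : Matrix (Fin n) (Fin n) (H →L[ℂ] H))
    (p : Fin n → (K →L[ℂ] H)) (u : Fin n → (H →L[ℂ] K))
    (hpu : ∀ i j x, p i (u j x) = if i = j then x else 0)
    (hadj : ∀ i x y, inner ℂ x (u i y) = inner ℂ (p i x) y)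
    (hinner : ∀ x y, inner ℂ x y = ∑ k, inner ℂ (p k x) (p k y))
    (h : ∀ x : Fin n → H, (0 : ℂ) ≤ ∑ i, ∑ j, inner ℂ (x i) (T i j (x j))) : IsPosElem T := by
  let S : K →L[ℂ] K := ∑ i, ∑ j, (u i).comp ((T i j).comp (p j))
  have hin : ∀ x y : K, inner ℂ x (S y) = ∑ i, ∑ j, inner ℂ (p i x) (T i j (p j y)) := by
    intro x y
    simp only [S, sum_apply, inner_sum, ContinuousLinearMap.comp_apply, hadj]
  obtain ⟨R, hR⟩ := op_sqrt_aux S (fun x => by rw [hin]; exact h _)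
  refine ⟨Matrix.of fun k j => (p k).comp (R.comp (u j)), ?_⟩
  ext i j y
  refine ext_inner_left ℂ fun x => ?_
  have e1 : inner ℂ x (T i j y) = inner ℂ (u i x) (S (u j y)) := by
    rw [hin]
    rw [Finset.sum_eq_single i, Finset.sum_eq_single j]
    · simp [hpu]
    · intro b _ hb; simp [hpu, hb]
    · simp
    · intro b _ hb; simp [hpu, hb]
    · simp
  rw [e1, hR]
  rw [Matrix.mul_apply, sum_apply, inner_sum]
  have e2 : inner ℂ (u i x) ((star R * R) (u j y)) = inner ℂ (R (u i x)) (R (u j y)) := by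
    rw [mul_apply_eq_comp, ContinuousLinearMap.star_eq_adjoint,
      ContinuousLinearMap.adjoint_inner_right]
  rw [e2, hinner]
  refine Finset.sum_congr rfl fun k _ => ?_
  rw [mul_apply_eq_comp, Matrix.star_apply, ContinuousLinearMap.star_eq_adjoint,
      ContinuousLinearMap.adjoint_inner_right]
  rfl

lemma posElem_of_forms {H : Type*} [NormedAddCommGroup H] [InnerProductSpace ℂ H] [CompleteSpace H]
    (n : ℕ) (T : Matrix (Fin n) (Fin n) (H →L[ℂ] H))
    (h : ∀ x : Fin n → H, (0 : ℂ) ≤ ∑ i, ∑ j, inner ℂ (x i) (T i j (x j))) : IsPosElem T := by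
  refine posElem_of_forms_abs (K := PiLp 2 (fun _ : Fin n => H)) n T
    (fun i => PiLp.proj 2 (fun _ : Fin n => H) i)
    (fun i => ContinuousLinearMap.adjoint (PiLp.proj 2 (fun _ : Fin n => H) i))
    ?_ (fun i x y => ContinuousLinearMap.adjoint_inner_right _ _ _)
    (fun x y => PiLp.inner_apply x y) h
  intro i j x
  refine ext_inner_left ℂ fun v => ?_
  have h1 : inner ℂ (WithLp.toLp 2 (Pi.single i v) : PiLp 2 (fun _ : Fin n => H))
        (ContinuousLinearMap.adjoint (PiLp.proj 2 (fun _ : Fin n => H) j :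
          PiLp 2 (fun _ : Fin n => H) →L[ℂ] H) x)
        = inner ℂ ((PiLp.proj 2 (fun _ : Fin n => H) j :
          PiLp 2 (fun _ : Fin n => H) →L[ℂ] H) (WithLp.toLp 2 (Pi.single i v))) x :=
      ContinuousLinearMap.adjoint_inner_right _ _ _
  rw [PiLp.inner_apply] at h1
  rw [Finset.sum_eq_single i] at h1
  · simp only [Pi.single_eq_same] at h1
    rw [PiLp.proj_apply, h1, PiLp.proj_apply]
    by_cases hij : i = j
    · subst hij; simp
    · simp [hij, Ne.symm hij]
  · intro b _ hb
    simp [hb]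
  · simp

lemma forms_of_posElem {H : Type*} [NormedAddCommGroup H] [InnerProductSpace ℂ H] [CompleteSpace H]
    (n : ℕ) (T : Matrix (Fin n) (Fin n) (H →L[ℂ] H)) (hT : IsPosElem T) (x : Fin n → H) :
    (0 : ℂ) ≤ ∑ i, ∑ j, inner ℂ (x i) (T i j (x j)) := by
  obtain ⟨b, rfl⟩ := hT
  have : ∑ i, ∑ j, inner ℂ (x i) ((star b * b) i j (x j))
      = ∑ k, inner ℂ (∑ i, b k i (x i)) (∑ j, b k j (x j)) := by
    simp only [sum_inner, inner_sum, Matrix.mul_apply, sum_apply]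
    conv_lhs => rw [Finset.sum_comm]
    conv_rhs => rw [Finset.sum_comm]
    refine Finset.sum_congr rfl fun i _ => ?_
    rw [Finset.sum_comm]
    refine Finset.sum_congr rfl fun k _ => ?_
    refine Finset.sum_congr rfl fun j _ => ?_
    rw [mul_apply_eq_comp, Matrix.star_apply, ContinuousLinearMap.star_eq_adjoint,
      ContinuousLinearMap.adjoint_inner_right]
  rw [this]
  refine Finset.sum_nonneg fun k _ => ?_
  rw [inner_self_eq_norm_sq_to_K]
  norm_cast
  positivity

section
variable {A : Type*} [NormedRing A] [StarRing A] [CStarRing A] [NormedAlgebra ℂ A]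
    [StarModule ℂ A] [CompleteSpace A]
    {H : Type*} [NormedAddCommGroup H] [InnerProductSpace ℂ H] [CompleteSpace H]

lemma cp_fintype (N : Submodule ℂ A) (τ : N →ₗ[ℂ] (H →L[ℂ] H)) (hτ : IsCPon N τ)
    {κ : Type*} [Fintype κ] (a : κ → κ → N) (B : κ → κ → A)
    (hB : ∀ i j, (a i j : A) = ∑ k, star (B k i) * B k j) (x : κ → H) :
    (0 : ℂ) ≤ ∑ i, ∑ j, inner ℂ (x i) (τ (a i j) (x j)) := by
  let e := Fintype.equivFin κ
  have h1 := hτ (Fintype.card κ) (Matrix.of fun i j => a (e.symm i) (e.symm j))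
    ⟨Matrix.of fun i j => B (e.symm i) (e.symm j), by
      ext i j
      rw [Matrix.mul_apply, Matrix.map_apply, Matrix.of_apply, hB]
      rw [← e.symm.sum_comp]
      rfl⟩
  have h2 := forms_of_posElem _ _ h1 (fun i => x (e.symm i))
  rw [← e.symm.sum_comp]
  refine h2.trans_eq (Finset.sum_congr rfl fun i _ => ?_)
  rw [← e.symm.sum_comp]
  rfl

/-- rectangular version -/
lemma cp_list (N : Submodule ℂ A) (τ : N →ₗ[ℂ] (H →L[ℂ] H)) (hτ : IsCPon N τ)
    {κ : Type*} [Fintype κ] (a : κ → κ → N) (L : List (κ → A))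
    (hB : ∀ i j, (a i j : A) = (L.map fun b => star (b i) * b j).sum) (x : κ → H) :
    (0 : ℂ) ≤ ∑ i, ∑ j, inner ℂ (x i) (τ (a i j) (x j)) := by
  have hL : ∀ i j, (a i j : A) = ∑ m : Fin L.length, star (L.get m i) * L.get m j := by
    intro i j
    rw [hB, ← List.sum_ofFn]
    congr 1
    apply List.ext_getElem <;> simp
  have := cp_fintype N τ hτ (κ := Fin L.length ⊕ κ)
    (fun p q => Sum.elim (fun _ => 0) (fun i => Sum.elim (fun _ => 0) (fun j => a i j) q) p)
    (fun k q => Sum.elim (fun m => Sum.elim (fun _ => 0) (fun j => L.get m j) q) (fun _ => 0) k)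
    (by
      rintro (i | i) (j | j)
      · simp
      · simp
      · simp
      · simp [hL])
    (Sum.elim (fun _ => 0) x)
  simpa using this

lemma exists_sqrt_sa {A : Type*} [NormedRing A] [StarRing A] [CStarRing A] [NormedAlgebra ℂ A]
    [StarModule ℂ A] [CompleteSpace A] (a : A) (ha : star a = a) :
    ∃ c : A, ((‖a‖ : ℝ) : ℂ) • (1 : A) + a = star c * c := by
  let : CStarAlgebra A := { }
  let := CStarAlgebra.spectralOrder A
  have := CStarAlgebra.spectralOrderedRing A
  have h := IsSelfAdjoint.neg_algebraMap_norm_le_self (a := a) ha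
  rw [neg_le_iff_add_nonneg, CStarAlgebra.nonneg_iff_eq_star_mul_self] at h
  obtain ⟨c, hc⟩ := h
  refine ⟨c, ?_⟩
  rw [← hc, Algebra.algebraMap_eq_smul_one, add_comm]
  congr 1

lemma cp_real (N : Submodule ℂ A) (hone : (1 : A) ∈ N)
    (τ : N →ₗ[ℂ] (H →L[ℂ] H)) (hτ : IsCPon N τ) (a : N) (ha : star (a : A) = a) (x : H) :
    (inner ℂ x (τ a x)).im = 0 := by
  have key : ∀ b : N, (∃ c : A, (b : A) = star c * c) → (inner ℂ x (τ b x)).im = 0 := by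
    rintro b ⟨c, hc⟩
    have := cp_list N τ hτ (κ := Unit) (fun _ _ => b) [fun _ => c] (by simpa using hc) (fun _ => x)
    simp only [Finset.univ_unique, Finset.sum_singleton] at this
    exact (Complex.nonneg_iff.mp this).2.symm
  have h1 := key ⟨1, hone⟩ ⟨1, by simp⟩
  have h2 := key (((‖(a : A)‖ : ℝ) : ℂ) • ⟨1, hone⟩ + a) (exists_sqrt_sa (a : A) ha)
  rw [map_add, map_smul] at h2
  simpa [inner_add_right, inner_smul_right, h1] using h2

lemma cp_star (N : Submodule ℂ A) (hstar : ∀ x ∈ N, star x ∈ N) (hone : (1 : A) ∈ N)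
    (τ : N →ₗ[ℂ] (H →L[ℂ] H)) (hτ : IsCPon N τ) (a : N) (x y : H) :
    (inner ℂ x (τ ⟨star (a : A), hstar a a.2⟩ y)) = inner ℂ (τ a x) y := by
  have : τ ⟨star (a : A), hstar a a.2⟩ = ContinuousLinearMap.adjoint (τ a) := by
    apply ContinuousLinearMap.coe_injective
    rw [← ext_inner_map]
    intro v
    simp only [ContinuousLinearMap.coe_coe, ContinuousLinearMap.adjoint_inner_left]
    have h1 := cp_real N hone τ hτ (a + ⟨star (a : A), hstar a a.2⟩) (by simp [add_comm]) v
    have h2 := cp_real N hone τ hτ (Complex.I • a - Complex.I • ⟨star (a : A), hstar a a.2⟩)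
      (by simp [add_comm, sub_eq_add_neg]) v
    rw [map_add] at h1
    rw [map_sub, map_smul, map_smul] at h2
    simp only [add_apply, sub_apply,
      smul_apply, inner_add_right, inner_sub_right, inner_smul_right,
      Complex.add_im, Complex.sub_im, Complex.mul_im, Complex.I_re, Complex.I_im] at h1 h2
    rw [← inner_conj_symm]
    apply Complex.ext
    · simp only [Complex.conj_re]; linarith
    · simp only [Complex.conj_im]; linarith
  rw [this, ContinuousLinearMap.adjoint_inner_right]
end
end ArvesonAux

section ArvesonMain

open scoped ComplexConjugate ComplexOrder

set_option linter.unusedSectionVars false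

variable {A : Type*} [NormedRing A] [StarRing A] [CStarRing A] [NormedAlgebra ℂ A]
    [StarModule ℂ A] [CompleteSpace A]
    {H : Type*} [NormedAddCommGroup H] [InnerProductSpace ℂ H] [CompleteSpace H]
    {I : Type*}

/-- Kernels which are finite sums of kernels `(i, j) ↦ b i* b j`. -/
def ArvPos (k : I → I → A) : Prop :=
  ∃ L : List (I →₀ A), ∀ i j, k i j = (L.map fun b => star (b i) * b j).sum

lemma ArvPos.add {k l : I → I → A} (hk : ArvPos k) (hl : ArvPos l) :
    ArvPos (fun i j => k i j + l i j) := by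
  obtain ⟨L, hL⟩ := hk
  obtain ⟨M, hM⟩ := hl
  exact ⟨L ++ M, fun i j => by simp [hL, hM]⟩

lemma ArvPos.smul {k : I → I → A} (hk : ArvPos k) {c : ℝ} (hc : 0 ≤ c) :
    ArvPos (fun i j => c • k i j) := by
  obtain ⟨L, hL⟩ := hk
  refine ⟨L.map fun b => ((Real.sqrt c : ℝ) : ℂ) • b, fun i j => ?_⟩
  simp only
  rw [hL, List.smul_sum, List.map_map, List.map_map]
  congr 1
  refine List.map_congr_left fun b _ => ?_
  simp only [Function.comp_apply, Finsupp.smul_apply, star_smul, smul_mul_smul_comm]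
  rw [show star ((Real.sqrt c : ℝ) : ℂ) * ((Real.sqrt c : ℝ) : ℂ) = ((c : ℝ) : ℂ) from ?_]
  · rw [Complex.coe_smul]
  · simp only [RCLike.star_def, Complex.conj_ofReal]
    rw [← Complex.ofReal_mul, Real.mul_self_sqrt hc]

/-- The cone of kernels whose hermitian part is positive. -/
def arvCone (A : Type*) [NormedRing A] [StarRing A] [CStarRing A] [NormedAlgebra ℂ A]
    [StarModule ℂ A] [CompleteSpace A] (I : Type*) : PointedCone ℝ (I × I →₀ A) where
  carrier := {w | ArvPos (fun i j => w (i, j) + star (w (j, i)))}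
  zero_mem' := ⟨[], fun i j => by simp⟩
  add_mem' := by
    intro v w hv hw
    have := hv.add hw
    simp only [Set.mem_ofPred_eq]
    convert this using 3
    simp only [Finsupp.add_apply, star_add]
    abel
  smul_mem' := by
    rintro ⟨c, hc⟩ w hw
    have := ArvPos.smul hw hc
    simp only [Set.mem_ofPred_eq]
    convert this using 3
    rename_i i j
    change c • w (i, j) + star (c • w (j, i)) = _
    rw [← Complex.coe_smul, ← Complex.coe_smul, ← Complex.coe_smul, star_smul, smul_add]
    simp

lemma mem_arvCone {w : I × I →₀ A} :
    w ∈ arvCone A I ↔ ArvPos (fun i j => w (i, j) + star (w (j, i))) := Iff.rfl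

lemma star_list_sum_aux (L : List (I →₀ A)) (i j : I) :
    star ((L.map fun b => star (b i) * b j).sum) = (L.map fun b => star (b j) * b i).sum := by
  induction L with
  | nil => simp
  | cons b L ih => simp [ih]

lemma mem_arvCone_of_pos {w : I × I →₀ A} (h : ArvPos (fun i j => w (i, j))) :
    w ∈ arvCone A I := by
  rw [mem_arvCone]
  have := h.add h
  convert this using 3
  obtain ⟨L, hL⟩ := h
  simp only at hL
  rw [hL, hL, star_list_sum_aux]

lemma mem_arvCone_of_skew {w : I × I →₀ A} (h : ∀ i j, w (i, j) + star (w (j, i)) = 0) :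
    w ∈ arvCone A I := ⟨[], fun i j => by simp [h]⟩

lemma arv_dense (N : Submodule ℂ A) (hone : (1 : A) ∈ N) (y : I × I →₀ A) :
    ∃ x : I × I →₀ A, (∀ p, x p ∈ N) ∧ x + y ∈ arvCone A I := by
  classical
  induction y using Finsupp.induction_linear with
  | zero => exact ⟨0, by simp, by simp⟩
  | add f g hf hg =>
    obtain ⟨x, hx, hx'⟩ := hf
    obtain ⟨y, hy, hy'⟩ := hg
    refine ⟨x + y, fun p => N.add_mem (hx p) (hy p), ?_⟩
    have := add_mem hx' hy'
    convert this using 1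
    abel
  | single p a =>
    obtain ⟨i, j⟩ := p
    obtain ⟨c, hc⟩ := exists_sqrt_aux a
    let r : ℂ := ((‖a‖ ^ 2 : ℝ) : ℂ)
    have hr : conj r = r := Complex.conj_ofReal _
    refine ⟨Finsupp.single (i, i) ((1 / 2 : ℂ) • (1 : A))
      + Finsupp.single (j, j) ((1 / 2 * r) • (1 : A)), fun p => ?_, ?_⟩
    · rw [Finsupp.add_apply, Finsupp.single_apply, Finsupp.single_apply]
      refine N.add_mem ?_ ?_ <;> split_ifs <;>
        first | exact N.zero_mem | exact N.smul_mem _ hone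
    · refine ⟨[Finsupp.single i 1 + Finsupp.single j a, Finsupp.single j c], fun k l => ?_⟩
      have hc' : star c * c = r • (1 : A) - star a * a := hc.symm
      have h2 : (1 / 2 : ℂ) • (1 : A) + (1 / 2 : ℂ) • (1 : A) = 1 := by
        rw [← add_smul]; norm_num
      have h3 : (1 / 2 * r) • (1 : A) + (1 / 2 * r) • (1 : A) = r • (1 : A) := by
        rw [← add_smul]; congr 1; ring
      have hs2 : star ((1 / 2 : ℂ) • (1 : A)) = (1 / 2 : ℂ) • (1 : A) := by
        rw [star_smul]; simp
      have hs3 : star ((1 / 2 * r) • (1 : A)) = (1 / 2 * r) • (1 : A) := by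
        rw [star_smul]; simp [hr]
      generalize (1 / 2 : ℂ) • (1 : A) = h at *
      generalize (1 / 2 * r) • (1 : A) = q at *
      generalize r • (1 : A) = R at *
      subst h3
      simp only [List.map_cons, List.map_nil, List.sum_cons, List.sum_nil, add_zero,
        Finsupp.add_apply, Finsupp.single_apply, Prod.mk.injEq]
      by_cases hik : i = k <;> by_cases hjk : j = k <;> by_cases hil : i = l <;>
        by_cases hjl : j = l <;>
        (try subst hik) <;> (try subst hjk) <;> (try subst hil) <;> (try subst hjl) <;>
        (try contradiction) <;>
        simp_all only [and_self, and_true, true_and, and_false, false_and, if_true, if_false,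
          add_zero, zero_add, star_zero, zero_mul, mul_zero, star_add, star_one, mul_one, one_mul,
          add_mul, mul_add, not_true_eq_false, eq_self_iff_true] <;>
        (try rw [← h2]) <;> (try abel)

lemma arv_nonneg (N : Submodule ℂ A) (hstar : ∀ x ∈ N, star x ∈ N) (hone : (1 : A) ∈ N)
    (τ : N →ₗ[ℂ] (H →L[ℂ] H)) (hτ : IsCPon N τ) (τ₀ : A →ₗ[ℂ] (H →L[ℂ] H))
    (h₀ : ∀ x : N, τ₀ x = τ x) (e : I → H) (w : I × I →₀ A) (hw : ∀ p, w p ∈ N)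
    (hc : w ∈ arvCone A I) :
    0 ≤ (w.sum fun p a => inner ℂ (e p.1) (τ₀ a (e p.2))).re := by
  classical
  obtain ⟨L, hL⟩ := hc
  let F : Finset I := w.support.image Prod.fst ∪ w.support.image Prod.snd
  have hF : w.support ⊆ F ×ˢ F := by
    intro p hp
    simp only [F, Finset.mem_product, Finset.mem_union, Finset.mem_image]
    exact ⟨Or.inl ⟨p, hp, rfl⟩, Or.inr ⟨p, hp, rfl⟩⟩
  have h1 : (w.sum fun p a => inner ℂ (e p.1) (τ₀ a (e p.2)))
      = ∑ i : F, ∑ j : F, inner ℂ (e i) (τ₀ (w (i, j)) (e j)) := by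
    rw [Finsupp.sum_of_support_subset _ hF _ (by simp), Finset.sum_product]
    rw [← Finset.sum_coe_sort F]
    refine Finset.sum_congr rfl fun i _ => ?_
    rw [← Finset.sum_coe_sort F]
  have h2 : (∑ i : F, ∑ j : F, inner ℂ (e i) (τ₀ (w (i, j)) (e j))).re
      = (∑ i : F, ∑ j : F, inner ℂ (e i) (τ₀ (star (w (j, i))) (e j))).re := by
    rw [Finset.sum_comm]
    simp only [Complex.re_sum]
    refine Finset.sum_congr rfl fun i _ => Finset.sum_congr rfl fun j _ => ?_
    have := cp_star N hstar hone τ hτ ⟨w (j, i), hw _⟩ (e i) (e j)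
    rw [← h₀, ← h₀] at this
    simp only at this
    rw [this, ← inner_conj_symm, Complex.conj_re]
  have h3 := cp_list N τ hτ (κ := F)
    (fun i j => ⟨w (i, j) + star (w (j, i)), N.add_mem (hw _) (hstar _ (hw _))⟩)
    (L.map fun b => fun i : F => b i)
    (fun i j => by rw [List.map_map]; exact hL i j) (fun i => e i)
  simp only [← h₀, map_add, add_apply, inner_add_right, Finset.sum_add_distrib] at h3
  have h4 := (Complex.nonneg_iff.mp h3).1
  rw [Complex.add_re, ← h2] at h4
  rw [h1]
  linarith
end ArvesonMain

section ArvesonFinal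

open scoped ComplexConjugate ComplexOrder

set_option linter.unusedSectionVars false

variable {A : Type*} [NormedRing A] [StarRing A] [CStarRing A] [NormedAlgebra ℂ A]
    [StarModule ℂ A] [CompleteSpace A]
    {H : Type*} [NormedAddCommGroup H] [InnerProductSpace ℂ H] [CompleteSpace H]
    {I : Type*}

lemma arv_functional (N : Submodule ℂ A) (hstar : ∀ x ∈ N, star x ∈ N) (hone : (1 : A) ∈ N)
    (τ : N →ₗ[ℂ] (H →L[ℂ] H)) (hτ : IsCPon N τ) (τ₀ : A →ₗ[ℂ] (H →L[ℂ] H))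
    (h₀ : ∀ x : N, τ₀ x = τ x) (e : I → H) :
    ∃ s : (I × I →₀ A) →ₗ[ℂ] ℂ,
      (∀ w : I × I →₀ A, (∀ p, w p ∈ N) →
        s w = w.sum fun p a => inner ℂ (e p.1) (τ₀ a (e p.2))) ∧
      (∀ w : I × I →₀ A, ArvPos (fun i j => w (i, j)) → 0 ≤ s w) ∧
      (∀ w : I × I →₀ A, (∀ i j, w (i, j) + star (w (j, i)) = 0) → (s w).re = 0) := by
  let φ : I × I → (A →ₗ[ℂ] ℂ) := fun p =>
    { toFun := fun a => inner ℂ (e p.1) (τ₀ a (e p.2))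
      map_add' := fun a b => by simp
      map_smul' := fun c a => by simp }
  let s₀ : (I × I →₀ A) →ₗ[ℂ] ℂ := Finsupp.lsum ℂ φ
  have hs₀ : ∀ w, s₀ w = w.sum fun p a => inner ℂ (e p.1) (τ₀ a (e p.2)) := fun w => rfl
  let D : Submodule ℝ (I × I →₀ A) :=
    { carrier := {w | ∀ p, w p ∈ N}
      zero_mem' := fun p => N.zero_mem
      add_mem' := fun hv hw p => N.add_mem (hv p) (hw p)
      smul_mem' := fun c w hw p => by
        rw [Finsupp.smul_apply, ← Complex.coe_smul]
        exact N.smul_mem _ (hw p) }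
  let f : (I × I →₀ A) →ₗ.[ℝ] ℝ :=
    ⟨D, (Complex.reLm ∘ₗ (s₀.restrictScalars ℝ)).domRestrict D⟩
  obtain ⟨g, hg1, hg2⟩ := riesz_extension (arvCone A I) f
    (fun x hx => arv_nonneg N hstar hone τ hτ τ₀ h₀ e x.1 x.2 hx)
    (fun y => by
      obtain ⟨x, hx, hx'⟩ := arv_dense N hone y
      exact ⟨⟨x, hx⟩, hx'⟩)
  have hg1' : ∀ w : I × I →₀ A, (∀ p, w p ∈ N) → g w = (s₀ w).re := fun w hw => hg1 ⟨w, hw⟩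
  have hskew : ∀ w : I × I →₀ A, (∀ i j, w (i, j) + star (w (j, i)) = 0) → g w = 0 := by
    intro w hw
    have h1 := hg2 w (mem_arvCone_of_skew hw)
    have h2 := hg2 (-w) (mem_arvCone_of_skew fun i j => by
      rw [Finsupp.neg_apply, Finsupp.neg_apply, star_neg, ← neg_add, hw, neg_zero])
    rw [map_neg] at h2
    linarith
  let s : (I × I →₀ A) →ₗ[ℂ] ℂ := Module.Dual.extendRCLike (𝕜 := ℂ) g
  have hs_re : ∀ w, (s w).re = g w := fun w => Module.Dual.re_extendRCLike_apply (𝕜 := ℂ) g w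
  have hs_im : ∀ w, (s w).im = - g (Complex.I • w) :=
    fun w => Module.Dual.im_extendRCLike_apply (𝕜 := ℂ) g w
  refine ⟨s, ?_, ?_, ?_⟩
  · intro w hw
    rw [← hs₀]
    apply Complex.ext
    · rw [hs_re, hg1' w hw]
    · rw [hs_im, hg1' _ (fun p => N.smul_mem _ (hw p)), map_smul]
      simp
  · intro w hw
    rw [Complex.nonneg_iff, hs_re, hs_im]
    refine ⟨hg2 w (mem_arvCone_of_pos hw), ?_⟩
    rw [hskew, neg_zero]
    intro i j
    obtain ⟨L, hL⟩ := hw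
    simp only at hL
    rw [Finsupp.smul_apply, Finsupp.smul_apply, star_smul, hL, hL, star_list_sum_aux]
    simp
  · intro w hw
    rw [hs_re, hskew w hw]

/-- The kernel `(i, j) ↦ conj (x i) * y j • a`. -/
noncomputable def arvT (e : Module.Basis I ℂ H) (x y : H) (a : A) : I × I →₀ A :=
  Finsupp.onFinset ((e.repr x).support ×ˢ (e.repr y).support)
    (fun p => (conj (e.repr x p.1) * e.repr y p.2) • a) (by
      intro p hp
      rw [Finset.mem_product, Finsupp.mem_support_iff, Finsupp.mem_support_iff]
      constructor <;> intro h <;> simp [h] at hp)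

lemma arvT_apply (e : Module.Basis I ℂ H) (x y : H) (a : A) (p : I × I) :
    arvT e x y a p = (conj (e.repr x p.1) * e.repr y p.2) • a := rfl

lemma arvT_sum (e : Module.Basis I ℂ H) (τ₀ : A →ₗ[ℂ] (H →L[ℂ] H)) (x y : H) (a : A) :
    ((arvT e x y a).sum fun p a => inner ℂ (e p.1) (τ₀ a (e p.2))) = inner ℂ x (τ₀ a y) := by
  unfold arvT
  rw [Finsupp.onFinset_sum _ (by simp), Finset.sum_product]
  have hx : x = ∑ i ∈ (e.repr x).support, e.repr x i • e i :=
    (e.linearCombination_repr x).symm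
  have hy : y = ∑ i ∈ (e.repr y).support, e.repr y i • e i :=
    (e.linearCombination_repr y).symm
  conv_rhs => rw [hx, hy]
  rw [map_sum, sum_inner]
  refine Finset.sum_congr rfl fun i _ => ?_
  rw [inner_sum]
  refine Finset.sum_congr rfl fun j _ => ?_
  simp only [map_smul, smul_apply, inner_smul_left, inner_smul_right]
  ring

lemma arvT_pos (e : Module.Basis I ℂ H) {n : ℕ} (b : Fin n → Fin n → A) (x : Fin n → H) :
    ArvPos (fun k l => (∑ i, ∑ j, arvT e (x i) (x j) (∑ m, star (b m i) * b m j)) (k, l)) := by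
  refine ⟨List.ofFn fun m => ∑ i, (e.repr (x i)).mapRange (fun c => c • b m i) (by simp),
    fun k l => ?_⟩
  rw [List.map_ofFn, List.sum_ofFn]
  simp only [Finsupp.finsetSum_apply, arvT_apply, Function.comp_apply, Finsupp.mapRange_apply,
    star_sum, star_smul, Finset.sum_mul_sum, smul_mul_smul_comm, Finset.smul_sum]
  conv_rhs => rw [Finset.sum_comm]
  refine Finset.sum_congr rfl fun i _ => ?_
  rw [Finset.sum_comm]
  rfl

lemma arv_op (e : Module.Basis I ℂ H) (s : (I × I →₀ A) →ₗ[ℂ] ℂ)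
    (hpos : ∀ w : I × I →₀ A, ArvPos (fun i j => w (i, j)) → 0 ≤ s w)
    (hskew : ∀ w : I × I →₀ A, (∀ i j, w (i, j) + star (w (j, i)) = 0) → (s w).re = 0)
    (T : H →L[ℂ] H) (hT : ∀ x, s (arvT e x x 1) = inner ℂ x (T x)) (a : A) :
    ∃ S : H →L[ℂ] H, ∀ x y, inner ℂ x (S y) = s (arvT e x y a) := by
  have hT' : ∀ x, (s (arvT e x x 1)).re ≤ ‖T‖ * ‖x‖ ^ 2 := by
    intro x
    rw [hT]
    calc (inner ℂ x (T x)).re ≤ ‖inner ℂ x (T x)‖ := Complex.re_le_norm _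
      _ ≤ ‖x‖ * ‖T x‖ := norm_inner_le_norm _ _
      _ ≤ ‖x‖ * (‖T‖ * ‖x‖) := by gcongr; exact T.le_opNorm x
      _ = _ := by ring
  have key : ∀ x y, -2 * (s (arvT e x y a)).re ≤ ‖T‖ * ‖x‖ ^ 2 + ‖a‖ ^ 2 * (‖T‖ * ‖y‖ ^ 2) := by
    intro x y
    obtain ⟨c, hc⟩ := exists_sqrt_aux a
    have h1 := hpos _ (arvT_pos e ![![1, a], ![0, c]] ![x, y])
    have hc' : star a * a + star c * c = ((‖a‖ ^ 2 : ℝ) : ℂ) • (1 : A) := by rw [← hc]; abel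
    have h4 : arvT e y y (((‖a‖ ^ 2 : ℝ) : ℂ) • (1 : A))
        = ((‖a‖ ^ 2 : ℝ) : ℂ) • arvT e y y (1 : A) := by
      ext p; simp only [arvT_apply, Finsupp.smul_apply, smul_smul, mul_comm]
    simp only [Fin.sum_univ_two, Matrix.cons_val_zero, Matrix.cons_val_one, Matrix.cons_val_fin_one,
      star_one, star_zero, mul_one, one_mul, mul_zero, zero_mul, add_zero, hc', map_add, h4,
      map_smul] at h1
    have h2 := (Complex.nonneg_iff.mp h1).1
    have h3 := hskew (arvT e y x (star a) - arvT e x y a) (by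
      intro i j
      simp only [Finsupp.sub_apply, arvT_apply, star_sub, star_smul, star_star, star_mul',
        RCLike.star_def, Complex.conj_conj]
      rw [mul_comm (e.repr x j), mul_comm (e.repr y j)]
      abel)
    rw [map_sub, Complex.sub_re] at h3
    simp only [Complex.add_re, smul_eq_mul, Complex.re_ofReal_mul] at h2
    have h5 := hT' x
    have h6 := mul_le_mul_of_nonneg_left (hT' y) (sq_nonneg ‖a‖)
    linarith
  let B : H →ₗ⋆[ℂ] H →ₗ[ℂ] ℂ := LinearMap.mk₂'ₛₗ (starRingEnd ℂ) (RingHom.id ℂ)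
    (fun x y => s (arvT e x y a))
    (fun x x' y => by
      rw [← map_add]; congr 1; ext p
      simp only [arvT_apply, Finsupp.add_apply, map_add, add_mul, add_smul])
    (fun c x y => by
      rw [← map_smul]; congr 1; ext p
      simp only [arvT_apply, Finsupp.smul_apply, map_smul, smul_smul, smul_eq_mul, map_mul,
        mul_assoc])
    (fun x y y' => by
      rw [← map_add]; congr 1; ext p
      simp only [arvT_apply, Finsupp.add_apply, map_add, mul_add, add_smul])
    (fun c x y => by
      rw [← map_smul]; congr 1; ext p
      simp only [arvT_apply, Finsupp.smul_apply, map_smul, smul_smul, smul_eq_mul,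
        RingHom.id_apply, mul_left_comm])
  have hB : ∀ x y, B x y = s (arvT e x y a) := fun x y => rfl
  have bound : ∀ x y, ‖B x y‖ ≤ (‖T‖ * (1 + ‖a‖ ^ 2) / 2) * ‖x‖ * ‖y‖ := by
    intro x y
    by_cases hz : B x y = 0
    · rw [hz, norm_zero]; positivity
    have hx : x ≠ 0 := by rintro rfl; simp at hz
    have hy : y ≠ 0 := by rintro rfl; simp at hz
    have nx : 0 < ‖x‖ := norm_pos_iff.mpr hx
    have ny : 0 < ‖y‖ := norm_pos_iff.mpr hy
    have nz : 0 < ‖B x y‖ := norm_pos_iff.mpr hz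
    have hk := key (((‖x‖⁻¹ : ℝ) : ℂ) • x) ((-(conj (B x y)) * ((‖B x y‖⁻¹ * ‖y‖⁻¹ : ℝ) : ℂ)) • y)
    rw [← hB, map_smulₛₗ B, LinearMap.smul_apply, map_smul, Complex.conj_ofReal] at hk
    have e1 : (((‖x‖⁻¹ : ℝ) : ℂ) • (-(conj (B x y)) * ((‖B x y‖⁻¹ * ‖y‖⁻¹ : ℝ) : ℂ)) • (B x y))
        = ((-(‖B x y‖ / (‖x‖ * ‖y‖)) : ℝ) : ℂ) := by
      have : conj (B x y) * B x y = ((‖B x y‖ ^ 2 : ℝ) : ℂ) := by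
        rw [Complex.conj_mul']; push_cast; rfl
      calc _ = - (conj (B x y) * B x y) * ((‖x‖⁻¹ * (‖B x y‖⁻¹ * ‖y‖⁻¹) : ℝ) : ℂ) := by
            simp only [smul_eq_mul]; push_cast; ring
        _ = ((-(‖B x y‖ ^ 2) * (‖x‖⁻¹ * (‖B x y‖⁻¹ * ‖y‖⁻¹)) : ℝ) : ℂ) := by
            rw [this]; push_cast; ring
        _ = _ := by congr 1; field_simp
    have e2 : ‖((‖x‖⁻¹ : ℝ) : ℂ) • x‖ = 1 := by
      rw [norm_smul, Complex.norm_real, norm_inv, norm_norm]; field_simp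
    have e3 : ‖(-(conj (B x y)) * ((‖B x y‖⁻¹ * ‖y‖⁻¹ : ℝ) : ℂ)) • y‖ = 1 := by
      rw [norm_smul, norm_mul, norm_neg, RCLike.norm_conj, Complex.norm_real, norm_mul, norm_inv,
        norm_inv, norm_norm, norm_norm]
      field_simp
    rw [e1, e2, e3, Complex.ofReal_re] at hk
    have : ‖B x y‖ / (‖x‖ * ‖y‖) ≤ ‖T‖ * (1 + ‖a‖ ^ 2) / 2 := by linarith
    rw [div_le_iff₀ (by positivity)] at this
    linarith
  let B' : H →L⋆[ℂ] H →L[ℂ] ℂ := LinearMap.mkContinuous₂ B _ bound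
  refine ⟨ContinuousLinearMap.adjoint (InnerProductSpace.continuousLinearMapOfBilin B'), ?_⟩
  intro x y
  rw [ContinuousLinearMap.adjoint_inner_right,
    InnerProductSpace.continuousLinearMapOfBilin_apply]
  rfl

end ArvesonFinal

/-- Arveson extension theorem: a completely positive map `τ : N → B(H)` on an
operator system `N ⊆ A` extends to a completely positive map on all of `A`. -/
theorem arveson_extension
    {A : Type*} [NormedRing A] [StarRing A] [CStarRing A] [NormedAlgebra ℂ A]
    [StarModule ℂ A] [CompleteSpace A]
    {H : Type*} [NormedAddCommGroup H] [InnerProductSpace ℂ H] [CompleteSpace H]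
    (N : Submodule ℂ A) (hclosed : IsClosed (N : Set A))
    (hstar : ∀ x ∈ N, star x ∈ N) (hone : (1 : A) ∈ N)
    (τ : N →ₗ[ℂ] (H →L[ℂ] H)) (hτ : IsCPon N τ) :
    ∃ τext : A →ₗ[ℂ] (H →L[ℂ] H),
      IsCPmap τext ∧ ∀ x : N, τext (x : A) = τ x := by
  obtain ⟨τ₀, hτ₀⟩ := LinearMap.exists_extend τ
  have h₀ : ∀ x : N, τ₀ x = τ x := fun x => by rw [← hτ₀]; rfl
  let e := Module.Basis.ofVectorSpace ℂ H
  obtain ⟨s, hs1, hs2, hs3⟩ := arv_functional N hstar hone τ hτ τ₀ h₀ e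
  have hN : ∀ (a : N) (x y : H), s (arvT e x y (a : A)) = inner ℂ x (τ a y) := by
    intro a x y
    rw [hs1 _ (fun p => N.smul_mem _ a.2), arvT_sum, h₀]
  choose S hS using arv_op e s hs2 hs3 (τ ⟨1, hone⟩) (fun x => hN ⟨1, hone⟩ x x)
  refine ⟨{ toFun := S, map_add' := ?_, map_smul' := ?_ }, ?_, ?_⟩
  · intro a b
    ext y
    refine ext_inner_left ℂ fun x => ?_
    rw [hS, add_apply, inner_add_right, hS, hS, ← map_add]
    congr 1
    ext p
    simp only [arvT_apply, Finsupp.add_apply, smul_add]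
  · intro c a
    ext y
    refine ext_inner_left ℂ fun x => ?_
    rw [hS, RingHom.id_apply, smul_apply, inner_smul_right, hS, ← smul_eq_mul, ← map_smul]
    congr 1
    ext p
    simp only [arvT_apply, Finsupp.smul_apply, smul_smul, mul_comm]
  · rintro n a ⟨b, rfl⟩
    apply posElem_of_forms
    intro x
    have := hs2 _ (arvT_pos e (fun i j => b i j) x)
    simp only [map_sum, ← hS] at this
    exact this
  · intro a
    ext y
    refine ext_inner_left ℂ fun x => ?_
    change inner ℂ x (S a y) = _
    rw [hS, hN]
end

section
/- A density matrix ρ on a finite-dimensional H₁ ⊗ H₂ is separable if and only if its entanglement of formation E(ρ) = inf { Σᵢ pᵢ S(Tr₂ |ψᵢ⟩⟨ψᵢ|) : ρ = Σᵢ pᵢ |ψᵢ⟩⟨ψᵢ| } equals zero. -/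
open Matrix ComplexOrder
open scoped Kronecker

variable {k l : ℕ}

/-- Partial trace over the second factor. -/
noncomputable def trSnd (ρ : Matrix (Fin k × Fin l) (Fin k × Fin l) ℂ) :
    Matrix (Fin k) (Fin k) ℂ :=
  Matrix.of fun i j => ∑ s : Fin l, ρ (i, s) (j, s)

/-- Von Neumann entropy `S(σ) = -Tr σ log σ`, expressed via eigenvalues. -/
noncomputable def vNEntropy {n : Type*} [Fintype n] [DecidableEq n]
    (σ : Matrix n n ℂ) : ℝ :=
  if h : σ.IsHermitian then -∑ i, h.eigenvalues i * Real.log (h.eigenvalues i) else 0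

/-- A density matrix is separable if it is a convex combination of tensor products of
density matrices. -/
def Separable (ρ : Matrix (Fin k × Fin l) (Fin k × Fin l) ℂ) : Prop :=
  ∃ (n : ℕ) (p : Fin n → ℝ) (σ₁ : Fin n → Matrix (Fin k) (Fin k) ℂ)
    (σ₂ : Fin n → Matrix (Fin l) (Fin l) ℂ),
    (∀ i, 0 ≤ p i) ∧ (∑ i, p i = 1) ∧
    (∀ i, (σ₁ i).PosSemidef ∧ (σ₁ i).trace = 1) ∧
    (∀ i, (σ₂ i).PosSemidef ∧ (σ₂ i).trace = 1) ∧
    ρ = ∑ i, (p i : ℂ) • (σ₁ i ⊗ₖ σ₂ i)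

/-- The set of average entanglement entropies over finite pure-state decompositions
of `ρ`; the entanglement of formation is its infimum. -/
def EoFSet (ρ : Matrix (Fin k × Fin l) (Fin k × Fin l) ℂ) : Set ℝ :=
  {x | ∃ (n : ℕ) (p : Fin n → ℝ) (ψ : Fin n → (Fin k × Fin l → ℂ)),
    (∀ i, 0 ≤ p i) ∧ (∑ i, p i = 1) ∧
    (∀ i, ∑ z, ‖ψ i z‖ ^ 2 = 1) ∧
    ρ = ∑ i, (p i : ℂ) • Matrix.vecMulVec (ψ i) (star (ψ i)) ∧
    x = ∑ i, p i * vNEntropy (trSnd (Matrix.vecMulVec (ψ i) (star (ψ i))))}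

section helpers

theorem isCompact_hull {E : Type*} [AddCommGroup E] [Module ℝ E] [TopologicalSpace E]
    [IsTopologicalAddGroup E] [ContinuousSMul ℝ E] [FiniteDimensional ℝ E]
    {K : Set E} (hK : IsCompact K) : IsCompact (convexHull ℝ K) := by
  classical
  rcases K.eq_empty_or_nonempty with rfl | ⟨x0, hx0⟩
  · simp
  set N := Module.finrank ℝ E + 1 with hN
  have key : convexHull ℝ K = (fun q : (Fin N → ℝ) × (Fin N → E) => ∑ i, q.1 i • q.2 i) ''
      (stdSimplex ℝ (Fin N) ×ˢ Set.univ.pi fun _ => K) := by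
    apply Set.Subset.antisymm
    · intro x hx
      obtain ⟨ι, _, z, w, hz, hai, hw, hw1, hx⟩ := eq_pos_convex_span_of_mem_convexHull hx
      have hcard : Fintype.card ι ≤ Fintype.card (Fin N) := by
        have h1 := hai.card_le_finrank_succ
        have h2 := Submodule.finrank_le (vectorSpan ℝ (Set.range z))
        rw [Fintype.card_fin]
        omega
      obtain ⟨e⟩ := Function.Embedding.nonempty_of_card_le hcard
      have hsum : ∀ {M : Type _} [AddCommMonoid M] (g : Fin N → M),
          (∀ a, a ∉ Set.range e → g a = 0) → ∑ a, g a = ∑ i, g (e i) := by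
        intro M _ g hg
        symm
        exact Fintype.sum_of_injective e e.injective _ _ (fun a ha => hg a ha) (fun _ => rfl)
      have hsum' : ∀ (g : Fin N → ℝ),
          (∀ a, a ∉ Set.range e → g a = 0) → ∑ a, g a = ∑ i, g (e i) := by
        intro g hg
        symm
        exact Fintype.sum_of_injective e e.injective _ _ (fun a ha => hg a ha) (fun _ => rfl)
      have hw0 : ∀ a, a ∉ Set.range e → Function.extend e w 0 a = 0 := by
        intro a ha
        rw [Function.extend_apply' _ _ _ ha]; rfl
      refine ⟨(Function.extend e w 0, Function.extend e z fun _ => x0), ⟨⟨?_, ?_⟩, ?_⟩, ?_⟩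
      · intro a
        by_cases ha : a ∈ Set.range e
        · obtain ⟨i, rfl⟩ := ha
          simp only [e.injective.extend_apply]
          exact (hw i).le
        · exact (hw0 a ha).ge
      · simp only
        rw [hsum' _ hw0]
        simpa only [e.injective.extend_apply] using hw1
      · intro a _
        by_cases ha : a ∈ Set.range e
        · obtain ⟨i, rfl⟩ := ha
          simp only [e.injective.extend_apply]
          exact hz ⟨i, rfl⟩
        · simp only [Function.extend_apply' _ _ _ ha]
          exact hx0
      · simp only
        rw [hsum _ (fun a ha => by rw [hw0 a ha, zero_smul])]
        simpa only [e.injective.extend_apply] using hx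
    · rintro x ⟨⟨w, z⟩, ⟨⟨hw0, hw1⟩, hz⟩, rfl⟩
      exact (convex_convexHull ℝ K).sum_mem (fun i _ => hw0 i) hw1
        (fun i _ => subset_convexHull ℝ K (hz i trivial))
  rw [key]
  refine ((isCompact_stdSimplex ℝ (Fin N)).prod (isCompact_univ_pi fun _ => hK)).image ?_
  fun_prop

theorem trace_sq_eig {n : Type*} [Fintype n] [DecidableEq n] {σ : Matrix n n ℂ}
    (h : σ.IsHermitian) : (σ * σ).trace = ((∑ i, h.eigenvalues i ^ 2 : ℝ) : ℂ) := by
  conv_lhs => rw [h.spectral_theorem, ← map_mul, Unitary.conjStarAlgAut_apply,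
    Matrix.trace_mul_cycle]
  simp [Matrix.trace, pow_two]

theorem spectral_sum {n : Type*} [Fintype n] [DecidableEq n] {σ : Matrix n n ℂ}
    (h : σ.PosSemidef) (ht : σ.trace = 1) :
    ∃ (p : n → ℝ) (u : n → n → ℂ), (∀ i, 0 ≤ p i) ∧ ∑ i, p i = 1 ∧
      (∀ i, ∑ z, ‖u i z‖ ^ 2 = 1) ∧ 
      σ = ∑ i, (p i : ℂ) • Matrix.vecMulVec (u i) (star (u i)) := by
  refine ⟨h.1.eigenvalues, fun i => h.1.eigenvectorBasis i, h.eigenvalues_nonneg, ?_, ?_, ?_⟩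
  · have := h.1.trace_eq_sum_eigenvalues
    rw [ht] at this
    apply Complex.ofReal_injective
    push_cast
    exact this.symm
  · intro i
    have := h.1.eigenvectorBasis.orthonormal.1 i
    rw [← EuclideanSpace.norm_sq_eq, this]; norm_num
  · conv_lhs => rw [h.1.spectral_theorem, Unitary.conjStarAlgAut_apply]
    ext a b
    rw [Matrix.mul_apply]
    simp only [Matrix.sum_apply, Matrix.smul_apply, Matrix.vecMulVec_apply,
      Matrix.mul_diagonal, Matrix.star_apply, Matrix.IsHermitian.eigenvectorUnitary_apply]
    refine Finset.sum_congr rfl fun i _ => ?_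
    simp
    ring

/-- the sum of squares of the minors -/
noncomputable def minorSum (ψ : Fin k × Fin l → ℂ) : ℝ :=
  ∑ i, ∑ j, ∑ s, ∑ t, ‖ψ (i, s) * ψ (j, t) - ψ (i, t) * ψ (j, s)‖ ^ 2

theorem minorSum_nonneg (ψ : Fin k × Fin l → ℂ) : 0 ≤ minorSum ψ := by
  unfold minorSum; positivity

theorem minor_zero {ψ : Fin k × Fin l → ℂ} (h : minorSum ψ = 0) (i j s t) :
    ψ (i, s) * ψ (j, t) = ψ (i, t) * ψ (j, s) := by
  unfold minorSum at h
  rw [Finset.sum_eq_zero_iff_of_nonneg (fun _ _ => by positivity)] at h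
  have h := h i (Finset.mem_univ _)
  rw [Finset.sum_eq_zero_iff_of_nonneg (fun _ _ => by positivity)] at h
  have h := h j (Finset.mem_univ _)
  rw [Finset.sum_eq_zero_iff_of_nonneg (fun _ _ => by positivity)] at h
  have h := h s (Finset.mem_univ _)
  rw [Finset.sum_eq_zero_iff_of_nonneg (fun _ _ => by positivity)] at h
  have h := h t (Finset.mem_univ _)
  simpa [sub_eq_zero] using h

theorem norm_sum_C {ι : Type*} [Fintype ι] {ψ : ι → ℂ} (h : ∑ z, ‖ψ z‖ ^ 2 = 1) :
    ∑ z, ψ z * star (ψ z) = 1 := by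
  have : ((∑ z, ‖ψ z‖ ^ 2 : ℝ) : ℂ) = 1 := by rw [h]; simp
  rw [← this]
  push_cast
  refine Finset.sum_congr rfl fun z _ => ?_
  simpa using Complex.mul_conj' (ψ z)

theorem trSnd_eq (ψ : Fin k × Fin l → ℂ) : trSnd (Matrix.vecMulVec ψ (star ψ)) =
    ∑ s, Matrix.vecMulVec (fun i => ψ (i, s)) (star fun i => ψ (i, s)) := by
  ext i j
  simp [trSnd, Matrix.sum_apply, Matrix.vecMulVec_apply]

theorem trSnd_psd (ψ : Fin k × Fin l → ℂ) : (trSnd (Matrix.vecMulVec ψ (star ψ))).PosSemidef := by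
  rw [trSnd_eq]
  exact Matrix.posSemidef_sum _ fun s _ => Matrix.posSemidef_vecMulVec_self_star _

theorem trSnd_trace {ψ : Fin k × Fin l → ℂ} (h : ∑ z, ‖ψ z‖ ^ 2 = 1) :
    (trSnd (Matrix.vecMulVec ψ (star ψ))).trace = 1 := by
  rw [← norm_sum_C h, Fintype.sum_prod_type]
  simp [trSnd, Matrix.trace, Matrix.vecMulVec_apply]

theorem minorSum_eq {ψ : Fin k × Fin l → ℂ} (h : ∑ z, ‖ψ z‖ ^ 2 = 1) :
    (minorSum ψ : ℂ) = 2 * (1 - (trSnd (Matrix.vecMulVec ψ (star ψ)) *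
      trSnd (Matrix.vecMulVec ψ (star ψ))).trace) := by
  have h1 := norm_sum_C h
  rw [Fintype.sum_prod_type] at h1
  have e1 : ∑ i, ∑ j, ∑ s, ∑ t, ψ (i, s) * ψ (j, t) * star (ψ (i, s) * ψ (j, t)) = 1 := by
    calc _ = (∑ i, ∑ s, ψ (i, s) * star (ψ (i, s))) * (∑ j, ∑ t, ψ (j, t) * star (ψ (j, t))) := by
          rw [Finset.sum_mul_sum]
          refine Finset.sum_congr rfl fun i _ => Finset.sum_congr rfl fun j _ => ?_
          rw [Finset.sum_mul_sum]
          refine Finset.sum_congr rfl fun s _ => Finset.sum_congr rfl fun t _ => ?_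
          simp only [star_mul']; ring
      _ = 1 := by rw [h1]; simp
  have e2 : ∑ i, ∑ j, ∑ s, ∑ t, ψ (i, t) * ψ (j, s) * star (ψ (i, t) * ψ (j, s)) = 1 := by
    rw [← e1]
    refine Finset.sum_congr rfl fun i _ => Finset.sum_congr rfl fun j _ => ?_
    exact Finset.sum_comm
  have e3 : ∑ i, ∑ j, ∑ s, ∑ t, ψ (i, s) * ψ (j, t) * star (ψ (i, t) * ψ (j, s)) =
      (trSnd (Matrix.vecMulVec ψ (star ψ)) * trSnd (Matrix.vecMulVec ψ (star ψ))).trace := by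
    simp only [Matrix.trace, Matrix.diag, Matrix.mul_apply, trSnd, Matrix.of_apply,
      Matrix.vecMulVec_apply, Pi.star_apply]
    refine Finset.sum_congr rfl fun i _ => Finset.sum_congr rfl fun j _ => ?_
    rw [Finset.sum_mul_sum]
    refine Finset.sum_congr rfl fun s _ => Finset.sum_congr rfl fun t _ => ?_
    simp only [star_mul']; ring
  have e4 : ∑ i, ∑ j, ∑ s, ∑ t, ψ (i, t) * ψ (j, s) * star (ψ (i, s) * ψ (j, t)) =
      (trSnd (Matrix.vecMulVec ψ (star ψ)) * trSnd (Matrix.vecMulVec ψ (star ψ))).trace := by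
    rw [← e3]
    refine Finset.sum_congr rfl fun i _ => Finset.sum_congr rfl fun j _ => ?_
    exact Finset.sum_comm
  have : (minorSum ψ : ℂ) = ∑ i, ∑ j, ∑ s, ∑ t,
      (ψ (i, s) * ψ (j, t) * star (ψ (i, s) * ψ (j, t)) + 
       ψ (i, t) * ψ (j, s) * star (ψ (i, t) * ψ (j, s)) -
       ψ (i, s) * ψ (j, t) * star (ψ (i, t) * ψ (j, s)) -
       ψ (i, t) * ψ (j, s) * star (ψ (i, s) * ψ (j, t))) := by
    unfold minorSum
    push_cast
    refine Finset.sum_congr rfl fun i _ => Finset.sum_congr rfl fun j _ =>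
      Finset.sum_congr rfl fun s _ => Finset.sum_congr rfl fun t _ => ?_
    rw [← Complex.mul_conj']
    simp only [starRingEnd_apply, star_sub]
    ring
  rw [this]
  simp only [Finset.sum_sub_distrib, Finset.sum_add_distrib]
  rw [e1, e2, e3, e4]
  ring

theorem entropy_ge {ψ : Fin k × Fin l → ℂ} (h : ∑ z, ‖ψ z‖ ^ 2 = 1) :
    minorSum ψ ≤ 2 * vNEntropy (trSnd (Matrix.vecMulVec ψ (star ψ))) := by
  have hp := trSnd_psd ψ
  have h1 := minorSum_eq h
  rw [trace_sq_eig hp.1, ← trSnd_trace h, hp.1.trace_eq_sum_eigenvalues] at h1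
  have h2 : minorSum ψ = 2 * (∑ i, hp.1.eigenvalues i - ∑ i, hp.1.eigenvalues i ^ 2) := by
    apply Complex.ofReal_injective
    rw [h1]
    push_cast
    rfl
  rw [h2, vNEntropy, dif_pos hp.1, ← Finset.sum_sub_distrib, ← Finset.sum_neg_distrib]
  gcongr with i _
  have h0 := hp.eigenvalues_nonneg i
  rcases h0.eq_or_lt with h0 | h0
  · rw [← h0]; simp
  · have := Real.log_le_sub_one_of_pos h0
    nlinarith

theorem entropy_nonneg {ψ : Fin k × Fin l → ℂ} (h : ∑ z, ‖ψ z‖ ^ 2 = 1) :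
    0 ≤ vNEntropy (trSnd (Matrix.vecMulVec ψ (star ψ))) := by
  linarith [entropy_ge h, minorSum_nonneg ψ]

theorem entropy_proj {n : Type*} [Fintype n] [DecidableEq n] {σ : Matrix n n ℂ}
    (h : σ * σ = σ) : vNEntropy σ = 0 := by
  unfold vNEntropy
  split_ifs with hh
  · rw [neg_eq_zero]
    refine Finset.sum_eq_zero fun i _ => ?_
    have h1 := hh.mulVec_eigenvectorBasis i
    have h2 : hh.eigenvalues i * hh.eigenvalues i = hh.eigenvalues i := by
      have h3 := congrArg (fun v => σ *ᵥ v) h1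
      rw [Matrix.mulVec_mulVec, h, Matrix.mulVec_smul, h1] at h3
      have hne : (⇑(hh.eigenvectorBasis i) : n → ℂ) ≠ 0 := by
        intro h0
        have := hh.eigenvectorBasis.orthonormal.ne_zero i
        apply this
        ext a
        exact congrFun h0 a
      rw [smul_smul] at h3
      exact (smul_left_injective ℝ hne h3).symm
    have : hh.eigenvalues i = 0 ∨ hh.eigenvalues i = 1 := by
      have : hh.eigenvalues i * (hh.eigenvalues i - 1) = 0 := by linarith
      rcases mul_eq_zero.1 this with h | h
      · left; exact h
      · right; linarith
    rcases this with h | h <;> simp [h]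
  · rfl

theorem prod_norm {u : Fin k → ℂ} {v : Fin l → ℂ} (hu : ∑ z, ‖u z‖ ^ 2 = 1)
    (hv : ∑ z, ‖v z‖ ^ 2 = 1) : ∑ z : Fin k × Fin l, ‖u z.1 * v z.2‖ ^ 2 = 1 := by
  rw [Fintype.sum_prod_type]
  simp only [norm_mul, mul_pow]
  rw [← Finset.sum_mul_sum, hu, hv, one_mul]

theorem entropy_prod {u : Fin k → ℂ} {v : Fin l → ℂ} (hu : ∑ z, ‖u z‖ ^ 2 = 1)
    (hv : ∑ z, ‖v z‖ ^ 2 = 1) :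
    vNEntropy (trSnd (Matrix.vecMulVec (fun z : Fin k × Fin l => u z.1 * v z.2)
      (star fun z : Fin k × Fin l => u z.1 * v z.2))) = 0 := by
  have e : trSnd (Matrix.vecMulVec (fun z : Fin k × Fin l => u z.1 * v z.2)
      (star fun z : Fin k × Fin l => u z.1 * v z.2)) = Matrix.vecMulVec u (star u) := by
    ext i j
    simp only [trSnd, Matrix.of_apply, Matrix.vecMulVec_apply, Pi.star_apply, star_mul']
    calc _ = u i * star (u j) * ∑ s, v s * star (v s) := by
          rw [Finset.mul_sum]
          exact Finset.sum_congr rfl fun s _ => by ring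
      _ = _ := by rw [norm_sum_C hv, mul_one]
  rw [e]
  apply entropy_proj
  rw [Matrix.vecMulVec_mul_vecMulVec]
  have : star u ⬝ᵥ u = 1 := by
    rw [dotProduct_comm, ← norm_sum_C hu]; rfl
  rw [this]; simp

theorem mem_EoFSet {ρ : Matrix (Fin k × Fin l) (Fin k × Fin l) ℂ} {ι : Type*} [Fintype ι]
    (p : ι → ℝ) (ψ : ι → (Fin k × Fin l → ℂ)) (hp : ∀ i, 0 ≤ p i) (hp1 : ∑ i, p i = 1)
    (hψ : ∀ i, ∑ z, ‖ψ i z‖ ^ 2 = 1)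
    (hρ : ρ = ∑ i, (p i : ℂ) • Matrix.vecMulVec (ψ i) (star (ψ i))) :
    ∑ i, p i * vNEntropy (trSnd (Matrix.vecMulVec (ψ i) (star (ψ i)))) ∈ EoFSet ρ := by
  let e := (Fintype.equivFin ι).symm
  refine ⟨Fintype.card ι, p ∘ e, ψ ∘ e, fun i => hp _, ?_, fun i => hψ _, ?_, ?_⟩
  · rw [← hp1]; exact e.sum_comp p
  · rw [hρ]; exact (e.sum_comp fun i => (p i : ℂ) • Matrix.vecMulVec (ψ i) (star (ψ i))).symm
  · exact (e.sum_comp fun i => p i * vNEntropy (trSnd (Matrix.vecMulVec (ψ i) (star (ψ i))))).symm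

theorem EoF_nonneg {ρ : Matrix (Fin k × Fin l) (Fin k × Fin l) ℂ} {x : ℝ} (hx : x ∈ EoFSet ρ) :
    0 ≤ x := by
  obtain ⟨n, p, ψ, hp, -, hψ, -, rfl⟩ := hx
  exact Finset.sum_nonneg fun i _ => mul_nonneg (hp i) (entropy_nonneg (hψ i))

theorem zero_mem_of_sep {ρ : Matrix (Fin k × Fin l) (Fin k × Fin l) ℂ} (h : Separable ρ) :
    0 ∈ EoFSet ρ := by
  obtain ⟨n, p, σ₁, σ₂, hp, hp1, h1, h2, rfl⟩ := h
  choose a u ha ha1 hu hσ1 using fun i => spectral_sum (h1 i).1 (h1 i).2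
  choose b v hb hb1 hv hσ2 using fun i => spectral_sum (h2 i).1 (h2 i).2
  have := mem_EoFSet (ρ := ∑ i, (p i : ℂ) • (σ₁ i ⊗ₖ σ₂ i)) (ι := Fin n × Fin k × Fin l)
    (fun q => p q.1 * (a q.1 q.2.1 * b q.1 q.2.2))
    (fun q z => u q.1 q.2.1 z.1 * v q.1 q.2.2 z.2)
    (fun q => mul_nonneg (hp _) (mul_nonneg (ha _ _) (hb _ _)))
    (by
      simp only [Fintype.sum_prod_type, ← Finset.mul_sum, hb1, ha1, mul_one, hp1])
    (fun q => prod_norm (hu _ _) (hv _ _))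
    (by
      rw [Fintype.sum_prod_type]
      refine Finset.sum_congr rfl fun i _ => ?_
      rw [Fintype.sum_prod_type]
      ext ⟨x, y⟩ ⟨z, w⟩
      rw [Matrix.smul_apply, Matrix.kroneckerMap_apply]
      conv_lhs => rw [hσ1 i, hσ2 i]
      simp only [Matrix.sum_apply, Matrix.smul_apply, Matrix.vecMulVec_apply, Pi.star_apply,
        star_mul', smul_eq_mul, Finset.sum_mul_sum]
      rw [Finset.mul_sum]
      simp only [Finset.mul_sum]
      refine Finset.sum_congr rfl fun j _ => Finset.sum_congr rfl fun t _ => ?_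
      push_cast
      ring)
  convert this using 1
  symm
  refine Finset.sum_eq_zero fun q _ => ?_
  rw [entropy_prod (hu _ _) (hv _ _), mul_zero]

theorem pure_sep {ψ : Fin k × Fin l → ℂ} (h : ∑ z, ‖ψ z‖ ^ 2 = 1) (hm : minorSum ψ = 0) :
    ∃ (σ₁ : Matrix (Fin k) (Fin k) ℂ) (σ₂ : Matrix (Fin l) (Fin l) ℂ),
      (σ₁.PosSemidef ∧ σ₁.trace = 1) ∧ (σ₂.PosSemidef ∧ σ₂.trace = 1) ∧
      Matrix.vecMulVec ψ (star ψ) = σ₁ ⊗ₖ σ₂ := by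
  refine ⟨trSnd (Matrix.vecMulVec ψ (star ψ)),
    ∑ i, Matrix.vecMulVec (fun s => ψ (i, s)) (star fun s => ψ (i, s)),
    ⟨trSnd_psd ψ, trSnd_trace h⟩,
    ⟨Matrix.posSemidef_sum _ fun s _ => Matrix.posSemidef_vecMulVec_self_star _, ?_⟩, ?_⟩
  · rw [← norm_sum_C h, Fintype.sum_prod_type, Matrix.trace_sum]
    simp [Matrix.trace, Matrix.vecMulVec_apply]
  · have h1 := norm_sum_C h
    rw [Fintype.sum_prod_type_right] at h1
    ext ⟨i, s⟩ ⟨j, t⟩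
    rw [Matrix.kroneckerMap_apply]
    simp only [trSnd, Matrix.of_apply, Matrix.sum_apply, Matrix.vecMulVec_apply, Pi.star_apply]
    rw [Finset.sum_mul_sum]
    calc ψ (i, s) * star (ψ (j, t)) 
        = ψ (i, s) * star (ψ (j, t)) * ∑ u, ∑ v, ψ (v, u) * star (ψ (v, u)) := by
          rw [h1, mul_one]
      _ = _ := by
          simp only [Finset.mul_sum]
          refine Finset.sum_congr rfl fun u _ => Finset.sum_congr rfl fun v _ => ?_
          have e1 := minor_zero hm i v u s
          have e2 := congrArg star (minor_zero hm j v u t)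
          simp only [star_mul'] at e2
          linear_combination (-(star (ψ (j, t)) * star (ψ (v, u)))) * e1 -
            (ψ (i, u) * ψ (v, s)) * e2

/-- pure states together with the minor sum -/
def pureGraph (k l : ℕ) : Set (Matrix (Fin k × Fin l) (Fin k × Fin l) ℂ × ℝ) :=
  (fun ψ => (Matrix.vecMulVec ψ (star ψ), minorSum ψ)) '' {ψ | ∑ z, ‖ψ z‖ ^ 2 = 1}

theorem pureGraph_compact : IsCompact (pureGraph k l) := by
  refine IsCompact.image ?_ ?_
  · refine (isCompact_univ_pi fun _ : Fin k × Fin l => isCompact_closedBall (0 : ℂ) 1).of_isClosed_subset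
      (isClosed_eq (by fun_prop) continuous_const) ?_
    intro ψ hψ z _
    have : ‖ψ z‖ ^ 2 ≤ 1 := by
      rw [← show ∑ z, ‖ψ z‖ ^ 2 = 1 from hψ]
      exact Finset.single_le_sum (f := fun z => ‖ψ z‖ ^ 2) (fun _ _ => by positivity)
        (Finset.mem_univ z)
    simpa using this
  · unfold minorSum
    refine Continuous.prodMk ?_ (by fun_prop)
    exact Continuous.matrix_vecMulVec continuous_id continuous_star

theorem sep_of_hull {ρ : Matrix (Fin k × Fin l) (Fin k × Fin l) ℂ}
    (h : (ρ, (0 : ℝ)) ∈ convexHull ℝ (pureGraph k l)) : Separable ρ := by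
  obtain ⟨ι, _, z, w, hz, -, hw, hw1, hx⟩ := eq_pos_convex_span_of_mem_convexHull h
  choose ψ hψ hzψ using fun i => hz ⟨i, rfl⟩
  have hρ := congrArg Prod.fst hx
  have h0 := congrArg Prod.snd hx
  simp only [Prod.fst_sum, Prod.snd_sum, Prod.smul_fst, Prod.smul_snd, ← hzψ] at hρ h0
  simp only [smul_eq_mul] at h0
  rw [Finset.sum_eq_zero_iff_of_nonneg
    (fun i _ => mul_nonneg (hw i).le (minorSum_nonneg _))] at h0
  have hm : ∀ i, minorSum (ψ i) = 0 := fun i => by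
    rcases mul_eq_zero.1 (h0 i (Finset.mem_univ i)) with h | h
    · exact absurd h (hw i).ne'
    · exact h
  choose σ₁ σ₂ h1 h2 h3 using fun i => pure_sep (hψ i) (hm i)
  let e := (Fintype.equivFin ι).symm
  refine ⟨Fintype.card ι, w ∘ e, σ₁ ∘ e, σ₂ ∘ e, fun i => (hw _).le, ?_, fun i => h1 _,
    fun i => h2 _, ?_⟩
  · rw [← hw1]; exact e.sum_comp w
  · rw [← hρ]
    refine Eq.trans ?_ (e.sum_comp fun i => (w i : ℂ) • (σ₁ i ⊗ₖ σ₂ i)).symm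
    refine Finset.sum_congr rfl fun i _ => ?_
    rw [h3]
    ext a b
    simp

theorem sep_of_inf {ρ : Matrix (Fin k × Fin l) (Fin k × Fin l) ℂ} (hne : (EoFSet ρ).Nonempty)
    (h : sInf (EoFSet ρ) = 0) : Separable ρ := by
  apply sep_of_hull
  have hcl : IsClosed (convexHull ℝ (pureGraph k l)) :=
    (isCompact_hull pureGraph_compact).isClosed
  have key : ∀ x ∈ EoFSet ρ, ∃ y, 0 ≤ y ∧ y ≤ 2 * x ∧ (ρ, y) ∈ convexHull ℝ (pureGraph k l) := by
    rintro x ⟨n, p, ψ, hp, hp1, hψ, hρ, rfl⟩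
    refine ⟨∑ i, p i * minorSum (ψ i),
      Finset.sum_nonneg fun i _ => mul_nonneg (hp i) (minorSum_nonneg _), ?_, ?_⟩
    · rw [Finset.mul_sum]
      refine Finset.sum_le_sum fun i _ => ?_
      have := mul_le_mul_of_nonneg_left (entropy_ge (hψ i)) (hp i)
      linarith
    · have := (convex_convexHull ℝ (pureGraph k l)).sum_mem (fun i _ => hp i) hp1
        (z := fun i => (Matrix.vecMulVec (ψ i) (star (ψ i)), minorSum (ψ i)))
        (fun i _ => subset_convexHull ℝ _ ⟨ψ i, hψ i, rfl⟩)
      convert this using 1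
      ext1
      · rw [hρ, Prod.fst_sum]
        dsimp only
        apply Finset.sum_congr rfl
        intro i _
        ext a b
        simp
      · rw [Prod.snd_sum]; rfl
  have hx : ∀ n : ℕ, ∃ y, 0 ≤ y ∧ y ≤ 2 * (1 / ((n : ℝ) + 1)) ∧
      (ρ, y) ∈ convexHull ℝ (pureGraph k l) := by
    intro n
    obtain ⟨x, hx, hlt⟩ := exists_lt_of_csInf_lt hne
      (show sInf (EoFSet ρ) < 1 / ((n : ℝ) + 1) by rw [h]; positivity)
    obtain ⟨y, h1, h2, h3⟩ := key x hx
    exact ⟨y, h1, by linarith, h3⟩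
  choose y hy0 hy1 hy2 using hx
  have hlim : Filter.Tendsto y Filter.atTop (nhds 0) := by
    refine squeeze_zero hy0 hy1 ?_
    simpa using (tendsto_one_div_add_atTop_nhds_zero_nat (𝕜 := ℝ)).const_mul 2
  exact hcl.mem_of_tendsto (tendsto_const_nhds.prodMk_nhds hlim) (Filter.Eventually.of_forall hy2)

end helpers

/-- A density matrix is separable iff its entanglement of formation vanishes. -/
theorem separable_iff_eof_zero
    (ρ : Matrix (Fin k × Fin l) (Fin k × Fin l) ℂ)
    (hpos : ρ.PosSemidef) (htr : ρ.trace = 1) :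
    Separable ρ ↔ sInf (EoFSet ρ) = 0 := by
  have hne : (EoFSet ρ).Nonempty := by
    obtain ⟨p, u, hp, hp1, hu, hρ⟩ := spectral_sum hpos htr
    exact ⟨_, mem_EoFSet p u hp hp1 hu hρ⟩
  constructor
  · intro h
    exact le_antisymm (csInf_le ⟨0, fun x hx => EoF_nonneg hx⟩ (zero_mem_of_sep h))
      (Real.sInf_nonneg fun x hx => EoF_nonneg hx)
  · exact sep_of_inf hne
end

section
/- Every positive linear map τ : M₂(ℂ) → M₂(ℂ) is decomposable: it can be written τ = τ₁ + τ₂ ∘ t where τ₁ and τ₂ are completely positive maps and t is the transposition map. -/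
open Matrix ComplexOrder

/-- The amplification `τ ⊗ id_r` of a linear map on matrix algebras. -/
def ampl {n m r : ℕ}
    (τ : Matrix (Fin n) (Fin n) ℂ →ₗ[ℂ] Matrix (Fin m) (Fin m) ℂ)
    (ρ : Matrix (Fin n × Fin r) (Fin n × Fin r) ℂ) :
    Matrix (Fin m × Fin r) (Fin m × Fin r) ℂ :=
  Matrix.of fun p q => τ (Matrix.of fun i j => ρ (i, p.2) (j, q.2)) p.1 q.1

/-- Complete positivity of a linear map between matrix algebras: all amplifications
preserve positive semidefiniteness. -/
def IsCP {n m : ℕ}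
    (τ : Matrix (Fin n) (Fin n) ℂ →ₗ[ℂ] Matrix (Fin m) (Fin m) ℂ) : Prop :=
  ∀ (r : ℕ) (ρ : Matrix (Fin n × Fin r) (Fin n × Fin r) ℂ),
    ρ.PosSemidef → (ampl τ ρ).PosSemidef

/-- The transposition map as a linear map on `M₂(ℂ)`. -/
def transposeMap : Matrix (Fin 2) (Fin 2) ℂ →ₗ[ℂ] Matrix (Fin 2) (Fin 2) ℂ where
  toFun a := aᵀ
  map_add' a b := Matrix.transpose_add a b
  map_smul' c a := Matrix.transpose_smul c a

namespace Stormer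

/-- Real `4 × 4` matrices, acting on Minkowski space. -/
abbrev W := Matrix (Fin 4) (Fin 4) ℝ

/-- The Minkowski bilinear form. -/
def jb (x y : Fin 4 → ℝ) : ℝ := x 0 * y 0 - x 1 * y 1 - x 2 * y 2 - x 3 * y 3

/-- The time direction. -/
def e0 : Fin 4 → ℝ := ![1, 0, 0, 0]

/-- The forward light cone. -/
def InC (x : Fin 4 → ℝ) : Prop := 0 ≤ x 0 ∧ 0 ≤ jb x x

/-- Cone preserving matrices. -/
def Pos (L : W) : Prop := ∀ x, InC x → InC (L *ᵥ x)

lemma jb_comb (x y : Fin 4 → ℝ) (s t : ℝ) :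
    jb (s • x + t • y) (s • x + t • y) =
      s ^ 2 * jb x x + 2 * s * t * jb x y + t ^ 2 * jb y y := by
  simp only [jb, Pi.add_apply, Pi.smul_apply, smul_eq_mul]; ring

lemma mv_comb (L : W) (x y : Fin 4 → ℝ) (s t : ℝ) :
    L *ᵥ (s • x + t • y) = s • (L *ᵥ x) + t • (L *ᵥ y) := by
  rw [mulVec_add, mulVec_smul, mulVec_smul]

lemma e0_inC : InC e0 := by
  simp [InC, e0, jb]

lemma jb_e0 : jb e0 e0 = 1 := by simp [e0, jb]

lemma jb_nonneg_of_pos {L : W} (hL : Pos L) {x : Fin 4 → ℝ} (hx : 0 ≤ jb x x) :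
    0 ≤ jb (L *ᵥ x) (L *ᵥ x) := by
  rcases le_total 0 (x 0) with h | h
  · exact (hL x ⟨h, hx⟩).2
  · have h1 : InC (-x) := ⟨by simpa using h, by simpa [jb] using hx⟩
    have := (hL _ h1).2
    rw [mulVec_neg] at this
    simpa [jb] using this

/-- The two-point inequality in the S-lemma. -/
lemma slemma_aux {L : W} (hL : Pos L) {x y : Fin 4 → ℝ} (hx : jb x x < 0) (hy : 0 < jb y y) :
    jb x x * jb (L *ᵥ y) (L *ᵥ y) ≤ jb (L *ᵥ x) (L *ᵥ x) * jb y y := by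
  set a := jb y y
  set b := jb x y
  set c := jb x x
  have hd : 0 < b ^ 2 - a * c := by nlinarith [mul_pos hy (neg_pos.2 hx), sq_nonneg b]
  set r := Real.sqrt (b ^ 2 - a * c) with hr
  have hr2 : r ^ 2 = b ^ 2 - a * c := Real.sq_sqrt hd.le
  have hr0 : 0 < r := Real.sqrt_pos.2 hd
  -- vectors a x + (-b ± r) y are null
  have h1 : 0 ≤ jb (a • x + (-b + r) • y) (a • x + (-b + r) • y) := by
    rw [jb_comb]; change 0 ≤ a ^ 2 * c + 2 * a * (-b + r) * b + (-b + r) ^ 2 * a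
    apply le_of_eq; linear_combination (-a) * hr2
  have h2 : 0 ≤ jb (a • x + (-b - r) • y) (a • x + (-b - r) • y) := by
    rw [jb_comb]; change 0 ≤ a ^ 2 * c + 2 * a * (-b - r) * b + (-b - r) ^ 2 * a
    apply le_of_eq; linear_combination (-a) * hr2
  have g1 := jb_nonneg_of_pos hL h1
  have g2 := jb_nonneg_of_pos hL h2
  rw [mv_comb, jb_comb] at g1 g2
  set A := jb (L *ᵥ x) (L *ᵥ x)
  set B := jb (L *ᵥ x) (L *ᵥ y)
  set C := jb (L *ᵥ y) (L *ᵥ y)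
  have hrb : b ^ 2 < r ^ 2 := by nlinarith [mul_pos hy (neg_pos.2 hx)]
  have hb := abs_lt_of_sq_lt_sq' hrb hr0.le
  have e1 : 0 ≤ (r + b) * (a ^ 2 * A + 2 * a * (-b + r) * B + (-b + r) ^ 2 * C) +
      (r - b) * (a ^ 2 * A + 2 * a * (-b - r) * B + (-b - r) ^ 2 * C) :=
    add_nonneg (mul_nonneg (by linarith) g1) (mul_nonneg (by linarith) g2)
  have e2 : (r + b) * (a ^ 2 * A + 2 * a * (-b + r) * B + (-b + r) ^ 2 * C) +
      (r - b) * (a ^ 2 * A + 2 * a * (-b - r) * B + (-b - r) ^ 2 * C) =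
      2 * r * a * (A * a - c * C) := by
    linear_combination (2 * r * C) * hr2
  rw [e2] at e1
  have := nonneg_of_mul_nonneg_right e1 (by positivity)
  linarith

lemma slemma {L : W} (hL : Pos L) : ∃ μ : ℝ, 0 ≤ μ ∧
    ∀ x, μ * jb x x ≤ jb (L *ᵥ x) (L *ᵥ x) := by
  let S : Set ℝ := {r | ∃ y, 0 < jb y y ∧ r = jb (L *ᵥ y) (L *ᵥ y) / jb y y}
  have hne : S.Nonempty := ⟨_, e0, by rw [jb_e0]; norm_num, rfl⟩
  have hS0 : ∀ r ∈ S, 0 ≤ r := by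
    rintro r ⟨y, hy, rfl⟩
    exact div_nonneg (jb_nonneg_of_pos hL hy.le) hy.le
  have hbdd : BddBelow S := ⟨0, hS0⟩
  refine ⟨sInf S, le_csInf hne hS0, fun x => ?_⟩
  rcases lt_trichotomy (jb x x) 0 with h | h | h
  · have : jb (L *ᵥ x) (L *ᵥ x) / jb x x ≤ sInf S := by
      apply le_csInf hne
      rintro r ⟨y, hy, rfl⟩
      rw [div_le_iff_of_neg h, div_mul_eq_mul_div, div_le_iff₀ hy]
      linarith [slemma_aux hL h hy]
    rwa [div_le_iff_of_neg h] at this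
  · rw [h, mul_zero]; exact jb_nonneg_of_pos hL h.ge
  · have : sInf S ≤ _ := csInf_le hbdd ⟨x, h, rfl⟩
    rwa [le_div_iff₀ h] at this

/-- Sufficient criterion for being cone preserving. -/
lemma pos_of_ineq {L : W} {μ : ℝ} (hμ : 0 < μ)
    (h : ∀ x, μ * jb x x ≤ jb (L *ᵥ x) (L *ᵥ x)) (h0 : 0 < (L *ᵥ e0) 0) : Pos L := by
  intro x hx
  refine ⟨?_, (mul_nonneg hμ.le hx.2).trans (h x)⟩
  by_contra hneg
  push Not at hneg
  set p := (L *ᵥ e0) 0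
  set q := (L *ᵥ x) 0
  have h1 := h ((-q) • e0 + p • x)
  rw [mv_comb, jb_comb] at h1
  have h2 : 0 < (-q) ^ 2 * jb e0 e0 + 2 * (-q) * p * jb e0 x + p ^ 2 * jb x x := by
    have a1 : jb e0 x = x 0 := by simp [jb, e0]
    rw [jb_e0, a1]
    have := mul_nonneg (mul_pos (neg_pos.2 hneg) h0).le hx.1
    have := mul_nonneg (sq_nonneg p) hx.2
    nlinarith [mul_pos (neg_pos.2 hneg) (neg_pos.2 hneg)]
  have h3 := mul_pos hμ h2
  have h4 : ((-q) • (L *ᵥ e0) + p • (L *ᵥ x)) 0 = 0 := by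
    simp only [Pi.add_apply, Pi.smul_apply, smul_eq_mul]
    change -q * p + p * q = 0
    ring
  have h5 : ∀ z : Fin 4 → ℝ, z 0 = 0 → jb z z ≤ 0 := by
    intro z hz
    simp only [jb, hz]; nlinarith [sq_nonneg (z 1), sq_nonneg (z 2), sq_nonneg (z 3)]
  linarith [h5 _ h4]

/-- Normalised cone preserving matrices. -/
def K : Set W := {L | Pos L ∧ (L *ᵥ e0) 0 = 1}

/-- Cone preserving matrices of norm at most one. -/
def KL : Set W := {L | Pos L ∧ (L *ᵥ e0) 0 ≤ 1}

lemma inC_add {x y : Fin 4 → ℝ} (hx : InC x) (hy : InC y) : InC (x + y) := by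
  obtain ⟨hx0, hx1⟩ := hx
  obtain ⟨hy0, hy1⟩ := hy
  refine ⟨add_nonneg hx0 hy0, ?_⟩
  have key : x 1 * y 1 + x 2 * y 2 + x 3 * y 3 ≤ x 0 * y 0 := by
    apply le_of_sq_le_sq _ (mul_nonneg hx0 hy0)
    simp only [jb] at hx1 hy1
    have a1 : x 1 ^ 2 + x 2 ^ 2 + x 3 ^ 2 ≤ x 0 ^ 2 := by linarith
    have a2 : y 1 ^ 2 + y 2 ^ 2 + y 3 ^ 2 ≤ y 0 ^ 2 := by linarith
    have := mul_le_mul a1 a2 (by positivity) (by positivity)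
    nlinarith [sq_nonneg (x 1 * y 2 - x 2 * y 1), sq_nonneg (x 1 * y 3 - x 3 * y 1),
      sq_nonneg (x 2 * y 3 - x 3 * y 2)]
  simp only [jb, Pi.add_apply] at *
  nlinarith

lemma inC_smul {x : Fin 4 → ℝ} (hx : InC x) {s : ℝ} (hs : 0 ≤ s) : InC (s • x) := by
  refine ⟨mul_nonneg hs hx.1, ?_⟩
  have := mul_nonneg (mul_nonneg hs hs) hx.2
  simp only [jb, Pi.smul_apply, smul_eq_mul] at *
  linarith

lemma pos_add {L M : W} (hL : Pos L) (hM : Pos M) : Pos (L + M) := fun x hx => by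
  rw [add_mulVec]; exact inC_add (hL x hx) (hM x hx)

lemma pos_smul {L : W} (hL : Pos L) {s : ℝ} (hs : 0 ≤ s) : Pos (s • L) := fun x hx => by
  rw [smul_mulVec]; exact inC_smul (hL x hx) hs

lemma convex_K : Convex ℝ K := by
  rintro A ⟨hA, hA1⟩ B ⟨hB, hB1⟩ s t hs ht hst
  refine ⟨pos_add (pos_smul hA hs) (pos_smul hB ht), ?_⟩
  rw [add_mulVec, smul_mulVec, smul_mulVec]
  simp [hA1, hB1, hst]

lemma convex_KL : Convex ℝ KL := by
  rintro A ⟨hA, hA1⟩ B ⟨hB, hB1⟩ s t hs ht hst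
  refine ⟨pos_add (pos_smul hA hs) (pos_smul hB ht), ?_⟩
  rw [add_mulVec, smul_mulVec, smul_mulVec]
  simp only [Pi.add_apply, Pi.smul_apply, smul_eq_mul]
  nlinarith

lemma cont_jb {X : Type*} [TopologicalSpace X] {f : X → Fin 4 → ℝ} (hf : Continuous f) :
    Continuous fun x => jb (f x) (f x) := by
  unfold jb; fun_prop

lemma cont_mv (x : Fin 4 → ℝ) : Continuous fun L : W => L *ᵥ x := by
  fun_prop

lemma closed_pos : IsClosed {L : W | Pos L} := by
  have : {L : W | Pos L} = ⋂ (x) (_ : InC x), {L : W | InC (L *ᵥ x)} := by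
    ext L; simp [Pos]
  rw [this]
  refine isClosed_iInter fun x => isClosed_iInter fun _ => ?_
  have h1 : IsClosed {L : W | 0 ≤ (L *ᵥ x) 0} :=
    isClosed_le continuous_const ((continuous_apply 0).comp (cont_mv x))
  have h2 : IsClosed {L : W | 0 ≤ jb (L *ᵥ x) (L *ᵥ x)} :=
    isClosed_le continuous_const (cont_jb (cont_mv x))
  exact h1.inter h2

lemma closed_KL : IsClosed KL :=
  closed_pos.inter (isClosed_le ((continuous_apply 0).comp (cont_mv e0)) continuous_const)

lemma closed_K : IsClosed K :=
  closed_pos.inter (isClosed_eq ((continuous_apply 0).comp (cont_mv e0)) continuous_const)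

lemma inC_bound {x : Fin 4 → ℝ} (hx : InC x) (i : Fin 4) : |x i| ≤ x 0 := by
  obtain ⟨h0, h1⟩ := hx
  apply abs_le_of_sq_le_sq _ h0
  simp only [jb] at h1
  fin_cases i <;> simp <;> nlinarith [sq_nonneg (x 1), sq_nonneg (x 2), sq_nonneg (x 3)]

lemma entry_bound {L : W} (hL : L ∈ KL) (i j : Fin 4) : |L i j| ≤ 3 := by
  obtain ⟨hP, h1⟩ := hL
  have b0 := inC_bound (hP _ e0_inC) i
  have hcol : L i j = (L *ᵥ (Pi.single j 1)) i := by simp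
  have he : e0 = Pi.single 0 1 := by ext k; fin_cases k <;> simp [e0]
  by_cases hj : j = 0
  · subst hj
    rw [hcol, ← he]; linarith
  · have c1 : InC (e0 + Pi.single j 1) := by
      fin_cases j <;> first | exact absurd rfl hj | (constructor <;> simp [jb, e0])
    have c2 : InC (e0 - Pi.single j 1) := by
      fin_cases j <;> first | exact absurd rfl hj | (constructor <;> simp [jb, e0])
    have d1 := inC_bound (hP _ c1) i
    have d2 := (hP _ c2).1
    have d3 := (hP _ c1).1
    rw [mulVec_add] at d1 d3
    rw [mulVec_sub] at d2
    simp only [Pi.add_apply, Pi.sub_apply] at d1 d2 d3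
    rw [hcol]
    rw [abs_le] at *
    constructor <;> linarith

lemma compact_KL : IsCompact KL := by
  have hc : IsCompact (Set.univ.pi fun _ : Fin 4 => Set.univ.pi fun _ : Fin 4 =>
      Set.Icc (-3 : ℝ) 3) :=
    isCompact_univ_pi fun _ => isCompact_univ_pi fun _ => isCompact_Icc
  refine IsCompact.of_isClosed_subset (X := W) hc closed_KL ?_
  intro L hL i _ j _
  exact abs_le.1 (entry_bound hL i j)

lemma K_subset_KL : K ⊆ KL := fun _ h => ⟨h.1, h.2.le⟩

lemma compact_K : IsCompact K := compact_KL.of_isClosed_subset closed_K K_subset_KL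

/-- Rank one (degenerate) matrices. -/
def Deg (L : W) : Prop := ∀ x, L *ᵥ x = (L *ᵥ x) 0 • (L *ᵥ e0)

lemma deg_of_zero {L : W} (hL : L ∈ K) (h : ∀ x, 0 ≤ jb (L *ᵥ x) (L *ᵥ x)) : Deg L := by
  intro x
  have h1 := h ((1 : ℝ) • x + (-(L *ᵥ x) 0) • e0)
  rw [mv_comb] at h1
  set z := (1 : ℝ) • (L *ᵥ x) + (-(L *ᵥ x) 0) • (L *ᵥ e0) with hz
  have hz0 : z 0 = 0 := by simp [hz, hL.2]
  have hz' : z = 0 := by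
    simp only [jb, hz0] at h1
    have a1 : z 1 = 0 := by nlinarith [sq_nonneg (z 1), sq_nonneg (z 2), sq_nonneg (z 3)]
    have a2 : z 2 = 0 := by nlinarith [sq_nonneg (z 1), sq_nonneg (z 2), sq_nonneg (z 3)]
    have a3 : z 3 = 0 := by nlinarith [sq_nonneg (z 1), sq_nonneg (z 2), sq_nonneg (z 3)]
    ext i; fin_cases i
    exacts [hz0, a1, a2, a3]
  rw [hz, one_smul, neg_smul, add_neg_eq_zero] at hz'
  exact hz'

/-- The matrix of the Minkowski form. -/
def D : W := diagonal ![1, -1, -1, -1]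

lemma jb_eq (x y : Fin 4 → ℝ) : jb x y = x ⬝ᵥ (D *ᵥ y) := by
  simp [jb, D, dotProduct, Fin.sum_univ_four, mulVec_diagonal]; ring

lemma extreme_dichotomy {L : W} (hL : L ∈ K.extremePoints ℝ) :
    Deg L ∨ ∃ μ : ℝ, 0 < μ ∧ ∀ x, jb (L *ᵥ x) (L *ᵥ x) = μ * jb x x := by
  have hK : L ∈ K := hL.1
  obtain ⟨μ, hμ0, hμ⟩ := slemma hK.1
  rcases hμ0.eq_or_lt with h0 | hpos
  · left
    apply deg_of_zero hK
    intro x; have := hμ x; rw [← h0, zero_mul] at this; exact this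
  by_cases hQ : ∀ x, jb (L *ᵥ x) (L *ᵥ x) = μ * jb x x
  · exact Or.inr ⟨μ, hpos, hQ⟩
  left
  push Not at hQ
  obtain ⟨v, hv⟩ := hQ
  have hq : 0 < jb (L *ᵥ v) (L *ᵥ v) - μ * jb v v :=
    sub_pos.2 (lt_of_le_of_ne (hμ v) (Ne.symm hv))
  set q := jb (L *ᵥ v) (L *ᵥ v) - μ * jb v v with hqdef
  set w : Fin 4 → ℝ := Lᵀ *ᵥ (D *ᵥ (L *ᵥ v)) - μ • (D *ᵥ v) with hw
  have hadj : ∀ x u : Fin 4 → ℝ, x ⬝ᵥ (Lᵀ *ᵥ u) = (L *ᵥ x) ⬝ᵥ u := by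
    intro x u
    rw [mulVec_transpose, dotProduct_comm, ← dotProduct_mulVec, dotProduct_comm]
  have hwx : ∀ x, x ⬝ᵥ w = jb (L *ᵥ x) (L *ᵥ v) - μ * jb x v := by
    intro x
    rw [hw, dotProduct_sub, dotProduct_smul, hadj, ← jb_eq, ← jb_eq, smul_eq_mul]
  -- Cauchy-Schwarz
  have hCS : ∀ x, (x ⬝ᵥ w) ^ 2 ≤ q * (jb (L *ᵥ x) (L *ᵥ x) - μ * jb x x) := by
    intro x
    have h1 := hμ (q • x + (-(x ⬝ᵥ w)) • v)
    rw [mv_comb, jb_comb, jb_comb] at h1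
    have h2 := hwx x
    set c := x ⬝ᵥ w
    have h3 : 0 ≤ q * (q * (jb (L *ᵥ x) (L *ᵥ x) - μ * jb x x) - c ^ 2) := by
      have : q * (q * (jb (L *ᵥ x) (L *ᵥ x) - μ * jb x x) - c ^ 2) =
        (q ^ 2 * jb (L *ᵥ x) (L *ᵥ x) + 2 * q * (-c) * jb (L *ᵥ x) (L *ᵥ v) +
          (-c) ^ 2 * jb (L *ᵥ v) (L *ᵥ v)) -
        μ * (q ^ 2 * jb x x + 2 * q * (-c) * jb x v + (-c) ^ 2 * jb v v) := by
        linear_combination (-2 * q * c) * h2 + c ^ 2 * hqdef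
      rw [this]; linarith
    have := nonneg_of_mul_nonneg_right h3 hq
    linarith
  have hw0 : w ≠ 0 := by
    intro h
    have := hwx v
    rw [h, dotProduct_zero] at this
    linarith
  -- choice of u
  have hu : ∃ (u : Fin 4 → ℝ) (κ : ℝ), u ≠ 0 ∧ ∀ x, jb (L *ᵥ x) u = κ * (x ⬝ᵥ w) := by
    by_cases hdet : (Lᵀ * D).det = 0
    · obtain ⟨u, hu0, hu⟩ := Matrix.exists_mulVec_eq_zero_iff.2 hdet
      refine ⟨u, 0, hu0, fun x => ?_⟩
      rw [jb_eq, ← hadj, mulVec_mulVec, hu, dotProduct_zero, zero_mul]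
    · have hs := Matrix.mulVec_surjective_iff_isUnit.2
        ((Matrix.isUnit_iff_isUnit_det _).2 (Ne.isUnit hdet))
      obtain ⟨u, hu⟩ := hs w
      refine ⟨u, 1, ?_, fun x => ?_⟩
      · rintro rfl
        apply hw0; rw [← hu, mulVec_zero]
      · rw [jb_eq, ← hadj, mulVec_mulVec, hu, one_mul]
  obtain ⟨u, κ, hu0, hu⟩ := hu
  set M : W := vecMulVec u w with hM
  have hMx : ∀ x, M *ᵥ x = (x ⬝ᵥ w) • u := by
    intro x
    rw [hM, vecMulVec_mulVec, dotProduct_comm]; ext i; simp [mul_comm]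
  -- small perturbations
  have hpert : ∀ t : ℝ, |2 * t * κ + t ^ 2 * jb u u| * q ≤ 1 → 0 < 1 + t * (M *ᵥ e0) 0 →
      Pos (L + t • M) := by
    intro t ht ht2
    refine pos_of_ineq hpos (fun x => ?_) ?_
    · have : (L + t • M) *ᵥ x = (1 : ℝ) • (L *ᵥ x) + (t * (x ⬝ᵥ w)) • u := by
        rw [add_mulVec, smul_mulVec, hMx, one_smul, smul_smul]
      rw [this, jb_comb, hu]
      have h1 := hCS x
      set c := x ⬝ᵥ w
      set g := jb (L *ᵥ x) (L *ᵥ x) - μ * jb x x with hg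
      set p := 2 * t * κ + t ^ 2 * jb u u with hp
      have hg0 : 0 ≤ g := sub_nonneg.2 (hμ x)
      have h2 : |p| * c ^ 2 ≤ g := by
        calc |p| * c ^ 2 ≤ |p| * (q * g) := by gcongr
          _ = (|p| * q) * g := by ring
          _ ≤ 1 * g := by gcongr
          _ = g := one_mul g
      have h3 : -(|p| * c ^ 2) ≤ p * c ^ 2 := by
        have := mul_le_mul_of_nonneg_right (neg_abs_le p) (sq_nonneg c)
        linarith
      have h4 : 1 ^ 2 * jb (L *ᵥ x) (L *ᵥ x) + 2 * 1 * (t * c) * (κ * c) +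
          (t * c) ^ 2 * jb u u = μ * jb x x + g + p * c ^ 2 := by
        rw [hg, hp]; ring
      rw [h4]; linarith
    · rw [add_mulVec, smul_mulVec]
      simp only [Pi.add_apply, Pi.smul_apply, smul_eq_mul, hK.2]
      exact ht2
  have hev : ∀ᶠ t : ℝ in nhds 0, |2 * t * κ + t ^ 2 * jb u u| * q < 1 ∧
      0 < 1 + t * (M *ᵥ e0) 0 ∧ |2 * (-t) * κ + (-t) ^ 2 * jb u u| * q < 1 ∧
      0 < 1 + (-t) * (M *ᵥ e0) 0 := by
    refine Filter.Eventually.and ?_ (Filter.Eventually.and ?_ (Filter.Eventually.and ?_ ?_))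
    · exact ContinuousAt.eventually_lt (f := fun t : ℝ => |2 * t * κ + t ^ 2 * jb u u| * q)
        (by fun_prop) continuousAt_const (by simp)
    · exact ContinuousAt.eventually_lt (g := fun t : ℝ => 1 + t * (M *ᵥ e0) 0)
        continuousAt_const (by fun_prop) (by simp)
    · exact ContinuousAt.eventually_lt
        (f := fun t : ℝ => |2 * (-t) * κ + (-t) ^ 2 * jb u u| * q)
        (by fun_prop) continuousAt_const (by simp)
    · exact ContinuousAt.eventually_lt (g := fun t : ℝ => 1 + (-t) * (M *ᵥ e0) 0)
        continuousAt_const (by fun_prop) (by simp)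
  obtain ⟨t, ⟨ht1, ht2, ht3, ht4⟩, ht0⟩ :=
    ((hev.filter_mono nhdsWithin_le_nhds).and
      (self_mem_nhdsWithin : {t : ℝ | 0 < t} ∈ nhdsWithin 0 (Set.Ioi 0))).exists
  have ht0 : 0 < t := ht0
  have P1 := hpert t ht1.le ht2
  have P2 := hpert (-t) ht3.le ht4
  set m := t * (M *ᵥ e0) 0 with hm
  have hp1 : 0 < 1 + m := ht2
  have hp2 : 0 < 1 - m := by have := ht4; rw [neg_mul] at this; linarith
  have K1 : (1 + m)⁻¹ • (L + t • M) ∈ K := by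
    refine ⟨pos_smul P1 (inv_nonneg.2 hp1.le), ?_⟩
    rw [smul_mulVec, add_mulVec, smul_mulVec]
    simp only [Pi.add_apply, Pi.smul_apply, smul_eq_mul, hK.2]
    exact inv_mul_cancel₀ hp1.ne'
  have K2 : (1 - m)⁻¹ • (L + (-t) • M) ∈ K := by
    refine ⟨pos_smul P2 (inv_nonneg.2 hp2.le), ?_⟩
    rw [smul_mulVec, add_mulVec, smul_mulVec]
    simp only [Pi.add_apply, Pi.smul_apply, smul_eq_mul, hK.2]
    rw [neg_mul, ← hm, ← sub_eq_add_neg]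
    exact inv_mul_cancel₀ hp2.ne'
  have hseg : L ∈ openSegment ℝ ((1 + m)⁻¹ • (L + t • M)) ((1 - m)⁻¹ • (L + (-t) • M)) := by
    refine ⟨(1 + m) / 2, (1 - m) / 2, by linarith, by linarith, by ring, ?_⟩
    rw [smul_smul, smul_smul]
    have a1 : (1 + m) / 2 * (1 + m)⁻¹ = 1 / 2 := by field_simp
    have a2 : (1 - m) / 2 * (1 - m)⁻¹ = 1 / 2 := by field_simp
    rw [a1, a2]
    module
  have hext := (mem_extremePoints.1 hL).2 _ K1 _ K2 hseg
  have h1 : L + t • M = (1 + m) • L := by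
    have := congrArg (fun A => (1 + m) • A) hext.1
    simp only [smul_smul, mul_inv_cancel₀ hp1.ne', one_smul] at this
    exact this
  have h2 : t • M = m • L := by
    rw [add_smul, one_smul] at h1
    exact add_left_cancel h1
  by_cases hm0 : m = 0
  · exfalso
    rw [hm0, zero_smul] at h2
    have hM0 : M = 0 := (smul_eq_zero.1 h2).resolve_left ht0.ne'
    have h3 := hMx v
    rw [hM0, zero_mulVec] at h3
    have h4 : v ⬝ᵥ w = q := hwx v
    rw [h4] at h3
    rcases smul_eq_zero.1 h3.symm with h | h
    · exact hq.ne' h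
    · exact hu0 h
  · have hLM : ∀ x, L *ᵥ x = (m⁻¹ * t * (x ⬝ᵥ w)) • u := by
      intro x
      have h3 : m • (L *ᵥ x) = t • (M *ᵥ x) := by rw [← smul_mulVec, ← h2, smul_mulVec]
      rw [hMx] at h3
      have := congrArg (fun A => m⁻¹ • A) h3
      simp only [smul_smul, inv_mul_cancel₀ hm0, one_smul] at this
      rw [this]; congr 1; ring
    intro x
    have h3 := hK.2
    rw [hLM e0] at h3 ⊢
    rw [hLM x, smul_smul]
    congr 1
    simp only [Pi.smul_apply, smul_eq_mul] at h3 ⊢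
    linear_combination (-(m⁻¹ * t * (x ⬝ᵥ w))) * h3

/-- Shorthand for `M₂(ℂ)`. -/
abbrev M2 := Matrix (Fin 2) (Fin 2) ℂ

/-- The Hermitian matrix attached to a point of Minkowski space. -/
def Xm (v : Fin 4 → ℝ) : M2 :=
  !![(v 0 : ℂ) + v 3, (v 1 : ℂ) - Complex.I * v 2; (v 1 : ℂ) + Complex.I * v 2, (v 0 : ℂ) - v 3]

/-- The (complex) Minkowski coordinates of a matrix. -/
noncomputable def cf (X : M2) : Fin 4 → ℂ :=
  ![(X 0 0 + X 1 1) / 2, (X 0 1 + X 1 0) / 2, Complex.I * (X 0 1 - X 1 0) / 2,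
    (X 0 0 - X 1 1) / 2]

/-- The linear map on `M₂(ℂ)` attached to a real matrix. -/
noncomputable def Phi (L : W) : M2 →ₗ[ℂ] M2 where
  toFun X := ∑ j, cf X j • Xm (fun i => L i j)
  map_add' X Y := by
    rw [← Finset.sum_add_distrib]
    refine Finset.sum_congr rfl fun j _ => ?_
    rw [← add_smul]; congr 1
    fin_cases j <;> simp [cf] <;> ring
  map_smul' c X := by
    rw [RingHom.id_apply, Finset.smul_sum]
    refine Finset.sum_congr rfl fun j _ => ?_
    rw [smul_smul]; congr 1
    fin_cases j <;> simp [cf] <;> ring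

lemma Phi_apply (L : W) (X : M2) : Phi L X = ∑ j, cf X j • Xm (fun i => L i j) := rfl

lemma Xm_add (u v : Fin 4 → ℝ) : Xm (u + v) = Xm u + Xm v := by
  ext i j; fin_cases i <;> fin_cases j <;> simp [Xm] <;> ring

lemma Xm_smul (c : ℝ) (v : Fin 4 → ℝ) : Xm (c • v) = (c : ℂ) • Xm v := by
  ext i j; fin_cases i <;> fin_cases j <;> simp [Xm] <;> ring

lemma Phi_add (L M : W) : Phi (L + M) = Phi L + Phi M := by
  refine LinearMap.ext fun X => ?_
  rw [LinearMap.add_apply, Phi_apply, Phi_apply, Phi_apply, ← Finset.sum_add_distrib]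
  refine Finset.sum_congr rfl fun j _ => ?_
  rw [← smul_add, ← Xm_add]; rfl

lemma Phi_smul (c : ℝ) (L : W) : Phi (c • L) = (c : ℂ) • Phi L := by
  refine LinearMap.ext fun X => ?_
  rw [LinearMap.smul_apply, Phi_apply, Phi_apply, Finset.smul_sum]
  refine Finset.sum_congr rfl fun j _ => ?_
  rw [smul_comm, ← Xm_smul]; rfl

lemma cf_Xm (v : Fin 4 → ℝ) (j : Fin 4) : cf (Xm v) j = v j := by
  fin_cases j <;> simp [cf, Xm] <;> ring_nf
  rw [Complex.I_sq]; ring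

lemma Phi_Xm (L : W) (v : Fin 4 → ℝ) : Phi L (Xm v) = Xm (L *ᵥ v) := by
  rw [Phi_apply]
  simp only [cf_Xm]
  ext i j
  fin_cases i <;> fin_cases j <;>
    simp [Xm, Fin.sum_univ_four, mulVec, dotProduct] <;> ring

lemma Xm_cf (X : M2) : ∑ j, cf X j • Xm (Pi.single j 1) = X := by
  ext i j
  fin_cases i <;> fin_cases j <;>
    simp [Xm, cf, Fin.sum_univ_four] <;> ring_nf <;> simp <;> ring

lemma map_ext {f g : M2 →ₗ[ℂ] M2} (h : ∀ j : Fin 4, f (Xm (Pi.single j 1)) = g (Xm (Pi.single j 1))) :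
    f = g := by
  refine LinearMap.ext fun X => ?_
  rw [← Xm_cf X, map_sum, map_sum]
  refine Finset.sum_congr rfl fun j _ => ?_
  rw [map_smul, map_smul, h]

lemma Xm_herm (v : Fin 4 → ℝ) : (Xm v)ᴴ = Xm v := by
  ext i j
  fin_cases i <;> fin_cases j <;> simp [Xm, conjTranspose_apply] <;> ring

lemma herm_eq {X : M2} (hX : Xᴴ = X) : X = Xm (fun j => (cf X j).re) := by
  have h00 := congrFun (congrFun hX 0) 0
  have h01 := congrFun (congrFun hX 0) 1
  have h11 := congrFun (congrFun hX 1) 1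
  simp only [conjTranspose_apply, Complex.ext_iff, Complex.star_def, Complex.conj_re,
    Complex.conj_im] at h00 h01 h11
  ext i j
  fin_cases i <;> fin_cases j <;> apply Complex.ext <;> simp [Xm, cf] <;> linarith [h00.2, h01.1, h01.2, h11.2]

lemma det_Xm (v : Fin 4 → ℝ) : (Xm v).det = (jb v v : ℂ) := by
  rw [det_fin_two]; simp [Xm, jb]; ring_nf; rw [Complex.I_sq]; ring

lemma psd_Xm {v : Fin 4 → ℝ} (hv : InC v) : (Xm v).PosSemidef := by
  refine PosSemidef.of_dotProduct_mulVec_nonneg (Xm_herm v) fun x => ?_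
  have hre : 0 ≤ (star x ⬝ᵥ Xm v *ᵥ x).re := by
    have e : (star x ⬝ᵥ Xm v *ᵥ x).re =
        (v 0 + v 3) * ((x 0).re ^ 2 + (x 0).im ^ 2) + (v 0 - v 3) * ((x 1).re ^ 2 + (x 1).im ^ 2)
        + 2 * v 1 * ((x 0).re * (x 1).re + (x 0).im * (x 1).im)
        + 2 * v 2 * ((x 0).re * (x 1).im - (x 0).im * (x 1).re) := by
      simp [Xm, dotProduct, mulVec, Fin.sum_univ_two]; ring
    rw [e]
    obtain ⟨h0, h1⟩ := hv
    simp only [jb] at h1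
    generalize (x 0).re = a
    generalize (x 0).im = b
    generalize (x 1).re = c
    generalize (x 1).im = d
    rcases h0.eq_or_lt with h | h
    · rw [← h] at h1 ⊢
      have a1 : v 1 = 0 := by nlinarith [sq_nonneg (v 1), sq_nonneg (v 2), sq_nonneg (v 3)]
      have a2 : v 2 = 0 := by nlinarith [sq_nonneg (v 1), sq_nonneg (v 2), sq_nonneg (v 3)]
      have a3 : v 3 = 0 := by nlinarith [sq_nonneg (v 1), sq_nonneg (v 2), sq_nonneg (v 3)]
      rw [a1, a2, a3]; simp
    · refine nonneg_of_mul_nonneg_right (a := 2 * v 0) ?_ (by linarith)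
      have m1 := mul_nonneg h1 (add_nonneg (sq_nonneg c) (sq_nonneg d))
      have m2 := mul_nonneg h1 (add_nonneg (sq_nonneg a) (sq_nonneg b))
      nlinarith [sq_nonneg ((v 0 + v 3) * a + v 1 * c + v 2 * d),
        sq_nonneg ((v 0 + v 3) * b + v 1 * d - v 2 * c),
        sq_nonneg ((v 0 - v 3) * c + v 1 * a - v 2 * b),
        sq_nonneg ((v 0 - v 3) * d + v 1 * b + v 2 * a)]
  have him : (star x ⬝ᵥ Xm v *ᵥ x).im = 0 := by
    simp [Xm, dotProduct, mulVec, Fin.sum_univ_two]; ring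
  rw [Complex.le_def]
  exact ⟨hre, him.symm⟩

lemma inC_of_psd {v : Fin 4 → ℝ} (h : (Xm v).PosSemidef) : InC v := by
  have h0 := h.diag_nonneg (i := 0)
  have h1 := h.diag_nonneg (i := 1)
  have hd := h.det_nonneg
  rw [det_Xm] at hd
  rw [Complex.le_def] at h0 h1
  have h0 := h0.1
  have h1 := h1.1
  simp [Xm] at h0 h1
  exact ⟨by linarith, by exact_mod_cast hd⟩

lemma psd_eq {X : M2} (h : X.PosSemidef) : ∃ v, InC v ∧ X = Xm v := by
  have e := herm_eq h.isHermitian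
  exact ⟨_, inC_of_psd (e ▸ h), e⟩

lemma Phi_pos {L : W} (hL : Pos L) {X : M2} (hX : X.PosSemidef) : (Phi L X).PosSemidef := by
  obtain ⟨v, hv, rfl⟩ := psd_eq hX
  rw [Phi_Xm]; exact psd_Xm (hL v hv)

lemma cf_conj (X : M2) (j : Fin 4) : cf Xᴴ j = star (cf X j) := by
  fin_cases j <;> simp [cf, conjTranspose_apply] <;> ring

lemma Phi_herm (L : W) (X : M2) : Phi L Xᴴ = (Phi L X)ᴴ := by
  rw [Phi_apply, Phi_apply, conjTranspose_sum]
  refine Finset.sum_congr rfl fun j _ => ?_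
  rw [conjTranspose_smul, Xm_herm, cf_conj]

/-- Every positive map comes from a cone preserving matrix. -/
lemma exists_rep (τ : M2 →ₗ[ℂ] M2) (hτ : ∀ a : M2, a.PosSemidef → (τ a).PosSemidef) :
    ∃ L, Pos L ∧ Phi L = τ := by
  have hh : ∀ j : Fin 4, ∃ u, τ (Xm (Pi.single j 1)) = Xm u := by
    intro j
    have c1 : InC (e0 + Pi.single j 1) := by
      fin_cases j <;> (constructor <;> simp [jb, e0])
    have h1 := (hτ _ (psd_Xm c1)).isHermitian
    have h2 := (hτ _ (psd_Xm e0_inC)).isHermitian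
    rw [Xm_add, map_add] at h1
    have h3 := h1.sub h2
    rw [add_sub_cancel_left] at h3
    exact ⟨_, herm_eq h3⟩
  choose u hu using hh
  have hP : Phi (Matrix.of fun i j => u j i) = τ := by
    refine map_ext fun j => ?_
    rw [hu, Phi_Xm]
    congr 1
    ext i; simp
  refine ⟨_, fun x hx => ?_, hP⟩
  apply inC_of_psd
  rw [← Phi_Xm, hP]
  exact hτ _ (psd_Xm hx)

lemma cp_conj {τ : M2 →ₗ[ℂ] M2} (A : M2) (h : ∀ X, τ X = A * X * Aᴴ) : IsCP τ := by
  intro r ρ hρ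
  have : ampl τ ρ = (Matrix.of fun (p : Fin 2 × Fin r) (q : Fin 2 × Fin r) =>
      if p.2 = q.2 then A p.1 q.1 else 0) * ρ * (Matrix.of fun (p : Fin 2 × Fin r)
      (q : Fin 2 × Fin r) => if p.2 = q.2 then A p.1 q.1 else 0)ᴴ := by
    ext ⟨a, s⟩ ⟨b, t⟩
    simp [ampl, h, mul_apply, Fintype.sum_prod_type, apply_ite]
  rw [this]
  exact hρ.mul_mul_conjTranspose_same _

lemma cp_add {f g : M2 →ₗ[ℂ] M2} (hf : IsCP f) (hg : IsCP g) : IsCP (f + g) := by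
  intro r ρ hρ
  have : ampl (f + g) ρ = ampl f ρ + ampl g ρ := by
    ext p q; simp [ampl]
  rw [this]
  exact (hf r ρ hρ).add (hg r ρ hρ)

lemma cp_smul {f : M2 →ₗ[ℂ] M2} (hf : IsCP f) {c : ℝ} (hc : 0 ≤ c) : IsCP ((c : ℂ) • f) := by
  intro r ρ hρ
  have : ampl ((c : ℂ) • f) ρ = (c : ℂ) • ampl f ρ := by
    ext p q; simp [ampl]
  rw [this]
  exact (hf r ρ hρ).smul (by exact_mod_cast hc)

lemma cp_zero : IsCP (0 : M2 →ₗ[ℂ] M2) := by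
  intro r ρ hρ
  have : ampl (0 : M2 →ₗ[ℂ] M2) ρ = 0 := by
    ext p q; simp [ampl]
  rw [this]
  exact PosSemidef.zero

lemma cp_rank_one {τ : M2 →ₗ[ℂ] M2} (φ : M2 →ₗ[ℂ] ℂ) (C : M2) (hC : C.PosSemidef)
    (hφ : ∀ X, X.PosSemidef → 0 ≤ φ X) (hφ2 : ∀ X, φ Xᴴ = star (φ X))
    (h : ∀ X, τ X = φ X • C) : IsCP τ := by
  intro r ρ hρ
  set R : Matrix (Fin r) (Fin r) ℂ :=
    Matrix.of fun s t => φ (Matrix.of fun i j => ρ (i, s) (j, t)) with hR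
  have hRpsd : R.PosSemidef := by
    refine PosSemidef.of_dotProduct_mulVec_nonneg ?_ fun x => ?_
    · ext s t
      rw [conjTranspose_apply]
      simp only [hR, Matrix.of_apply]
      rw [← hφ2]
      congr 1
      ext i j
      exact congrFun (congrFun hρ.isHermitian (i, s)) (j, t)
    · set B : Matrix (Fin 2) (Fin 2 × Fin r) ℂ :=
        Matrix.of fun i p => if i = p.1 then star (x p.2) else 0 with hB
      have h1 := hφ _ (hρ.mul_mul_conjTranspose_same B)
      have h2 : B * ρ * Bᴴ = ∑ s, ∑ t, (star (x s) * x t) •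
          (Matrix.of fun i j => ρ (i, s) (j, t) : M2) := by
        ext i j
        simp [hB, mul_apply, Fintype.sum_prod_type, Matrix.sum_apply, apply_ite,
          Finset.sum_mul]
        rw [Finset.sum_comm]
        refine Finset.sum_congr rfl fun s _ => Finset.sum_congr rfl fun t _ => ?_
        ring
      rw [h2] at h1
      convert h1 using 1
      simp only [map_sum, map_smul, smul_eq_mul, dotProduct, mulVec, Pi.star_apply,
        Finset.mul_sum, hR, Matrix.of_apply]
      refine Finset.sum_congr rfl fun s _ => Finset.sum_congr rfl fun t _ => ?_
      ring
  have : ampl τ ρ = Matrix.kroneckerMap (· * ·) C R := by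
    ext ⟨a, s⟩ ⟨b, t⟩
    simp [ampl, h, hR, mul_comm]
  rw [this]
  exact hC.kronecker hRpsd

lemma cp_deg {L : W} (hL : Pos L) (hd : Deg L) : IsCP (Phi L) := by
  let φ : M2 →ₗ[ℂ] ℂ := ((1 : ℂ) / 2) • (Matrix.traceLinearMap (Fin 2) ℂ ℂ ∘ₗ Phi L)
  have hφX : ∀ X, φ X = (1 : ℂ) / 2 * (Phi L X).trace := fun X => rfl
  refine cp_rank_one φ (Xm (L *ᵥ e0)) (psd_Xm (hL _ e0_inC)) (fun X hX => ?_) (fun X => ?_)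
    (fun X => ?_)
  · rw [hφX]
    exact mul_nonneg (by norm_num [Complex.le_def]) (Phi_pos hL hX).trace_nonneg
  · rw [hφX, hφX, Phi_herm, trace_conjTranspose]; simp
  · have : Phi L = φ.smulRight (Xm (L *ᵥ e0)) := by
      refine map_ext fun j => ?_
      rw [LinearMap.smulRight_apply, hφX, Phi_Xm, hd (Pi.single j 1), Xm_smul]
      set u := L *ᵥ e0
      set c := (L *ᵥ Pi.single j 1) 0 with hc
      have h1 : u 0 * c = c := by
        have := congrFun (hd (Pi.single j 1)) 0
        simp only [Pi.smul_apply, smul_eq_mul] at this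
        linarith
      have h2 : (u 0 : ℂ) * c = c := by exact_mod_cast h1
      congr 1
      rw [trace_smul, trace_fin_two]
      simp [Xm]
      linear_combination -h2
    rw [this]; rfl

lemma closed_psd {n : Type*} [Fintype n] : IsClosed {A : Matrix n n ℂ | A.PosSemidef} := by
  have : {A : Matrix n n ℂ | A.PosSemidef} = {A | Aᴴ = A} ∩
      ⋂ x : n → ℂ, {A | 0 ≤ star x ⬝ᵥ (A *ᵥ x)} := by
    ext A
    simp only [Set.mem_ofPred_eq, Set.mem_inter_iff, Set.mem_iInter]
    exact posSemidef_iff_dotProduct_mulVec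
  rw [this]
  refine IsClosed.inter (isClosed_eq (by fun_prop) continuous_id) (isClosed_iInter fun x => ?_)
  exact isClosed_le continuous_const (by fun_prop)

lemma closed_cp {F : W → (M2 →ₗ[ℂ] M2)} (hF : ∀ X i j, Continuous fun L => F L X i j) :
    IsClosed {L | IsCP (F L)} := by
  have : {L | IsCP (F L)} = ⋂ (r : ℕ) (ρ : Matrix (Fin 2 × Fin r) (Fin 2 × Fin r) ℂ)
      (_ : ρ.PosSemidef), {L | (ampl (F L) ρ).PosSemidef} := by
    ext L; simp [IsCP]
  rw [this]
  refine isClosed_iInter fun r => isClosed_iInter fun ρ => isClosed_iInter fun _ => ?_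
  refine closed_psd.preimage (f := fun L => ampl (F L) ρ) ?_
  refine continuous_matrix fun p q => hF _ _ _

lemma cont_Phi (X : M2) (i j : Fin 2) : Continuous fun L : W => Phi L X i j := by
  simp only [Phi_apply, Matrix.sum_apply, Matrix.smul_apply, smul_eq_mul]
  refine continuous_finsetSum _ fun k _ => Continuous.mul continuous_const ?_
  have h : ∀ a : Fin 4, Continuous fun L : W => (L a k : ℂ) := fun a =>
    Complex.continuous_ofReal.comp ((continuous_apply k).comp (continuous_apply a))
  have h0 := h 0
  have h1 := h 1
  have h2 := h 2
  have h3 := h 3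
  fin_cases i <;> fin_cases j <;> simp [Xm] <;> fun_prop

lemma rank_one_psd {A : M2} (hA : A.PosSemidef) (hd : A.det = 0) :
    ∃ a b : ℂ, A = !![a * star a, a * star b; b * star a, b * star b] := by
  obtain ⟨v, hv, rfl⟩ := psd_eq hA
  rw [det_Xm] at hd
  have hd : jb v v = 0 := by exact_mod_cast hd
  have h0 : 0 ≤ v 0 + v 3 := by
    have := (abs_le.1 (inC_bound hv 3)).1; linarith
  have h1 : 0 ≤ v 0 - v 3 := by
    have := (abs_le.1 (inC_bound hv 3)).2; linarith
  simp only [jb] at hd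
  rcases h0.eq_or_lt with h | h
  · have e3 : v 3 = - v 0 := by linarith
    have e1 : v 1 = 0 := by rw [e3] at hd; nlinarith [sq_nonneg (v 1), sq_nonneg (v 2)]
    have e2 : v 2 = 0 := by rw [e3] at hd; nlinarith [sq_nonneg (v 1), sq_nonneg (v 2)]
    refine ⟨0, (Real.sqrt (v 0 - v 3) : ℂ), ?_⟩
    have hs : ((Real.sqrt (v 0 - v 3) : ℝ) : ℂ) * (Real.sqrt (v 0 - v 3) : ℝ) = v 0 - v 3 := by
      rw [← Complex.ofReal_mul, Real.mul_self_sqrt h1]; push_cast; rfl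
    have e3' : (v 3 : ℂ) = - v 0 := by exact_mod_cast e3
    ext i j
    fin_cases i <;> fin_cases j <;> simp [Xm, e1, e2, hs, e3']
  · set s := Real.sqrt (v 0 + v 3) with hs
    have hs0 : 0 < s := Real.sqrt_pos.2 h
    have hss : s * s = v 0 + v 3 := Real.mul_self_sqrt h0
    have hsc : (s : ℂ) * s = v 0 + v 3 := by exact_mod_cast hss
    have hsn : (s : ℂ) ≠ 0 := by exact_mod_cast hs0.ne'
    have hdc : (v 0 : ℂ) * v 0 - v 1 * v 1 - v 2 * v 2 - v 3 * v 3 = 0 := by exact_mod_cast hd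
    refine ⟨s, ((v 1 : ℂ) + Complex.I * v 2) / s, ?_⟩
    ext i j
    fin_cases i <;> fin_cases j <;> simp [Xm]
    · exact hsc.symm
    · field_simp; ring
    · field_simp
    · field_simp
      linear_combination ((v 0 : ℂ) - v 3) * hsc + hdc + (v 2 : ℂ) ^ 2 * Complex.I_sq

lemma diag_conj (a b : ℂ) (X : M2) :
    !![a, 0; 0, b] * X * (!![a, 0; 0, b] : M2)ᴴ =
      !![a * star a * X 0 0, a * star b * X 0 1; b * star a * X 1 0, b * star b * X 1 1] := by
  ext i j
  rw [Matrix.mul_apply, Fin.sum_univ_two, Matrix.mul_apply, Matrix.mul_apply, Fin.sum_univ_two,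
    Fin.sum_univ_two, conjTranspose_apply, conjTranspose_apply]
  fin_cases i <;> fin_cases j <;> simp <;> ring

lemma lorentz_case {τ : M2 →ₗ[ℂ] M2} (hτ : ∀ X, X.PosSemidef → (τ X).PosSemidef)
    (hh : ∀ X, τ Xᴴ = (τ X)ᴴ) {μ : ℝ} (hμ : 0 < μ)
    (hdet : ∀ v, (τ (Xm v)).det = μ * (Xm v).det) :
    IsCP τ ∨ IsCP (τ ∘ₗ transposeMap) := by
  have x0 : Xm ![1/2, 0, 0, 1/2] = !![1, 0; 0, 0] := by
    ext i j; fin_cases i <;> fin_cases j <;> simp [Xm] <;> norm_num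
  have x1 : Xm ![1/2, 0, 0, -1/2] = !![0, 0; 0, 1] := by
    ext i j; fin_cases i <;> fin_cases j <;> simp [Xm] <;> norm_num
  have c0 : InC ![1/2, 0, 0, 1/2] := by constructor <;> simp [jb]
  have c1 : InC ![1/2, 0, 0, -1/2] := by
    constructor <;> simp [jb]
    norm_num
  have d0 : (τ !![1, 0; 0, 0]).det = 0 := by
    rw [← x0, hdet, x0, det_fin_two]; simp
  have d1 : (τ !![0, 0; 0, 1]).det = 0 := by
    rw [← x1, hdet, x1, det_fin_two]; simp
  obtain ⟨a1, a2, ha⟩ := rank_one_psd (hτ _ (x0 ▸ psd_Xm c0)) d0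
  obtain ⟨b1, b2, hb⟩ := rank_one_psd (hτ _ (x1 ▸ psd_Xm c1)) d1
  set G : M2 := !![a1, b1; a2, b2] with hG
  have hA : τ !![1, 0; 0, 0] = G * !![1, 0; 0, 0] * Gᴴ := by
    rw [ha]; ext i j; fin_cases i <;> fin_cases j <;>
      simp [hG, mul_apply, Fin.sum_univ_two, conjTranspose_apply]
  have hB : τ !![0, 0; 0, 1] = G * !![0, 0; 0, 1] * Gᴴ := by
    rw [hb]; ext i j; fin_cases i <;> fin_cases j <;>
      simp [hG, mul_apply, Fin.sum_univ_two, conjTranspose_apply]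
  have hGdet : G.det * Gᴴ.det = μ := by
    have h1 : Xm e0 = !![1, 0; 0, 0] + !![0, 0; 0, 1] := by
      ext i j; fin_cases i <;> fin_cases j <;> simp [Xm, e0]
    have h2 : (!![1, 0; 0, 0] + !![0, 0; 0, 1] : M2) = 1 := by
      ext i j; fin_cases i <;> fin_cases j <;> simp
    have h3 := hdet e0
    rw [h1, map_add, hA, hB, ← add_mul, ← mul_add, h2, det_mul, det_mul, det_one] at h3
    simpa using h3
  have hμc : (μ : ℂ) ≠ 0 := by exact_mod_cast hμ.ne'
  have hG1 : G.det ≠ 0 := by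
    intro h; rw [h, zero_mul] at hGdet; exact hμc hGdet.symm
  have hG2 : Gᴴ.det ≠ 0 := by
    intro h; rw [h, mul_zero] at hGdet; exact hμc hGdet.symm
  obtain ⟨N, hN⟩ : ∃ N : M2, τ !![0, 1; 0, 0] = G * N * Gᴴ := by
    refine ⟨G⁻¹ * τ !![0, 1; 0, 0] * Gᴴ⁻¹, ?_⟩
    rw [← mul_assoc, ← mul_assoc, mul_nonsing_inv _ (Ne.isUnit hG1), one_mul, mul_assoc,
      nonsing_inv_mul _ (Ne.isUnit hG2), mul_one]
  have hN' : τ !![0, 0; 1, 0] = G * Nᴴ * Gᴴ := by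
    have : (!![0, 0; 1, 0] : M2) = (!![0, 1; 0, 0] : M2)ᴴ := by
      ext i j; fin_cases i <;> fin_cases j <;> simp [conjTranspose_apply]
    rw [this, hh, hN, conjTranspose_mul, conjTranspose_mul, conjTranspose_conjTranspose, mul_assoc]
  have hall : ∀ X : M2, τ X = G * (X 0 0 • !![1, 0; 0, 0] + X 1 1 • !![0, 0; 0, 1] +
      X 0 1 • N + X 1 0 • Nᴴ) * Gᴴ := by
    intro X
    have hX : X = X 0 0 • !![1, 0; 0, 0] + X 1 1 • !![0, 0; 0, 1] +
      X 0 1 • !![0, 1; 0, 0] + X 1 0 • !![0, 0; 1, 0] := by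
      ext i j; fin_cases i <;> fin_cases j <;> simp
    conv_lhs => rw [hX]
    rw [map_add, map_add, map_add, map_smul, map_smul, map_smul, map_smul, hA, hB, hN, hN']
    simp only [mul_add, add_mul, Matrix.mul_smul, Matrix.smul_mul]
  have hdet2 : ∀ v, (Xm v 0 0 • !![1, 0; 0, 0] + Xm v 1 1 • !![0, 0; 0, 1] +
      Xm v 0 1 • N + Xm v 1 0 • Nᴴ : M2).det = (jb v v : ℂ) := by
    intro v
    have h1 := hdet v
    rw [hall, det_mul, det_mul, det_Xm, mul_right_comm, hGdet] at h1
    exact mul_left_cancel₀ hμc h1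
  have hre : ∀ v, ((v 0 + v 3) + 2 * (v 1 * (N 0 0).re + v 2 * (N 0 0).im)) *
      ((v 0 - v 3) + 2 * (v 1 * (N 1 1).re + v 2 * (N 1 1).im)) -
      ((v 1 * ((N 0 1).re + (N 1 0).re) + v 2 * ((N 0 1).im + (N 1 0).im)) ^ 2 +
       (v 1 * ((N 0 1).im - (N 1 0).im) - v 2 * ((N 0 1).re - (N 1 0).re)) ^ 2) = jb v v := by
    intro v
    have h1 := congrArg Complex.re (hdet2 v)
    rw [det_fin_two] at h1
    simp [Xm, conjTranspose_apply] at h1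
    rw [← h1]; ring
  have i1 := hre ![0, 1, 0, 0]
  have i2 := hre ![1, 1, 0, 0]
  have i3 := hre ![0, 1, 0, 1]
  have i4 := hre ![-1, 1, 0, 0]
  have j1 := hre ![0, 0, 1, 0]
  have j2 := hre ![1, 0, 1, 0]
  have j3 := hre ![0, 0, 1, 1]
  have j4 := hre ![-1, 0, 1, 0]
  have k1 := hre ![0, 1, 1, 0]
  simp [jb] at i1 i2 i3 i4 j1 j2 j3 j4 k1
  have r1 : (N 0 0).re = 0 := by linarith
  have r4 : (N 1 1).re = 0 := by linarith
  have s1 : (N 0 0).im = 0 := by linarith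
  have s4 : (N 1 1).im = 0 := by linarith
  have n1 : N 0 0 = 0 := Complex.ext r1 s1
  have n4 : N 1 1 = 0 := Complex.ext r4 s4
  rw [r1, r4] at i1
  rw [s1, s4] at j1
  rw [r1, r4, s1, s4] at k1
  have hprod : N 0 1 * N 1 0 = 0 := by
    apply Complex.ext
    · simp only [Complex.mul_re, Complex.zero_re]; linarith
    · simp only [Complex.mul_im, Complex.zero_im]; linarith
  have hnorm : (N 0 1).re ^ 2 + (N 0 1).im ^ 2 + (N 1 0).re ^ 2 + (N 1 0).im ^ 2 = 1 := by
    linarith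
  have hunit : ∀ z : ℂ, z.re ^ 2 + z.im ^ 2 = 1 → z * star z = 1 := by
    intro z hz
    apply Complex.ext
    · simp; linarith
    · simp; ring
  rcases mul_eq_zero.1 hprod with h | h
  · right
    rw [h] at hnorm
    have hu := hunit (N 1 0) (by simpa using hnorm)
    refine cp_conj (G * !![1, 0; 0, N 1 0]) fun X => ?_
    have : (τ ∘ₗ transposeMap) X = τ Xᵀ := rfl
    have hZ : (Xᵀ 0 0 • !![1, 0; 0, 0] + Xᵀ 1 1 • !![0, 0; 0, 1] + Xᵀ 0 1 • N + Xᵀ 1 0 • Nᴴ : M2)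
        = !![1, 0; 0, N 1 0] * X * (!![1, 0; 0, N 1 0] : M2)ᴴ := by
      rw [diag_conj, hu]
      ext i j
      fin_cases i <;> fin_cases j <;> simp [n1, n4, h, conjTranspose_apply] <;> exact mul_comm _ _
    rw [this, hall, hZ, conjTranspose_mul]
    simp only [mul_assoc]
  · left
    rw [h] at hnorm
    have hu := hunit (N 0 1) (by simpa using hnorm)
    refine cp_conj (G * !![N 0 1, 0; 0, 1]) fun X => ?_
    have hZ : (X 0 0 • !![1, 0; 0, 0] + X 1 1 • !![0, 0; 0, 1] + X 0 1 • N + X 1 0 • Nᴴ : M2)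
        = !![N 0 1, 0; 0, 1] * X * (!![N 0 1, 0; 0, 1] : M2)ᴴ := by
      rw [diag_conj, hu]
      ext i j
      fin_cases i <;> fin_cases j <;> simp [n1, n4, h, conjTranspose_apply] <;> exact mul_comm _ _
    rw [hall, hZ, conjTranspose_mul]
    simp only [mul_assoc]

lemma transpose_comp (f : M2 →ₗ[ℂ] M2) : (f ∘ₗ transposeMap) ∘ₗ transposeMap = f := by
  refine LinearMap.ext fun X => ?_
  change f (Xᵀᵀ) = f X
  rw [transpose_transpose]

/-- Normalised matrices inducing completely positive maps. -/
def S1 : Set W := {L | L ∈ KL ∧ IsCP (Phi L)}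

/-- Normalised matrices inducing completely copositive maps. -/
def S2 : Set W := {L | L ∈ KL ∧ IsCP (Phi L ∘ₗ transposeMap)}

lemma compact_S1 : IsCompact S1 :=
  compact_KL.inter_right (closed_cp (F := fun L => Phi L) cont_Phi)

lemma compact_S2 : IsCompact S2 :=
  compact_KL.inter_right (closed_cp (F := fun L => Phi L ∘ₗ transposeMap)
    fun X i j => cont_Phi (transposeMap X) i j)

lemma convex_S1 : Convex ℝ S1 := by
  rintro A ⟨hA, hA1⟩ B ⟨hB, hB1⟩ s t hs ht hst
  refine ⟨convex_KL hA hB hs ht hst, ?_⟩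
  rw [Phi_add, Phi_smul, Phi_smul]
  exact cp_add (cp_smul hA1 hs) (cp_smul hB1 ht)

lemma convex_S2 : Convex ℝ S2 := by
  rintro A ⟨hA, hA1⟩ B ⟨hB, hB1⟩ s t hs ht hst
  refine ⟨convex_KL hA hB hs ht hst, ?_⟩
  rw [Phi_add, Phi_smul, Phi_smul, LinearMap.add_comp, LinearMap.smul_comp, LinearMap.smul_comp]
  exact cp_add (cp_smul hA1 hs) (cp_smul hB1 ht)

lemma Phi_zero : Phi 0 = 0 := by
  have := Phi_smul 0 0
  simpa using this

lemma zero_mem_KL : (0 : W) ∈ KL := by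
  refine ⟨fun x _ => ?_, ?_⟩
  · rw [zero_mulVec]; simp [InC, jb]
  · rw [zero_mulVec]; simp

lemma zero_S1 : (0 : W) ∈ S1 := ⟨zero_mem_KL, by rw [Phi_zero]; exact cp_zero⟩

lemma zero_S2 : (0 : W) ∈ S2 := ⟨zero_mem_KL, by
  rw [Phi_zero, LinearMap.zero_comp]; exact cp_zero⟩

open scoped Pointwise in
lemma extreme_mem {L : W} (hL : L ∈ K.extremePoints ℝ) : L ∈ S1 + S2 := by
  have hK : L ∈ K := hL.1
  have key : L ∈ S1 ∨ L ∈ S2 := by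
    rcases extreme_dichotomy hL with h | ⟨μ, hμ, h⟩
    · exact Or.inl ⟨K_subset_KL hK, cp_deg hK.1 h⟩
    · rcases lorentz_case (τ := Phi L) (fun X hX => Phi_pos hK.1 hX) (Phi_herm L) hμ
        (fun v => by rw [Phi_Xm, det_Xm, det_Xm, h]; push_cast; rfl) with h | h
      · exact Or.inl ⟨K_subset_KL hK, h⟩
      · exact Or.inr ⟨K_subset_KL hK, h⟩
  rcases key with h | h
  · exact ⟨L, h, 0, zero_S2, add_zero L⟩
  · exact ⟨0, zero_S1, L, h, zero_add L⟩

instance : LocallyConvexSpace ℝ W :=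
  inferInstanceAs (LocallyConvexSpace ℝ (Fin 4 → Fin 4 → ℝ))

open scoped Pointwise in
lemma K_subset : K ⊆ S1 + S2 := by
  rw [← closure_convexHull_extremePoints compact_K convex_K]
  exact closure_minimal (convexHull_min (fun L hL => extreme_mem hL) (convex_S1.add convex_S2))
    (compact_S1.add compact_S2).isClosed

end Stormer

/-- Størmer–Woronowicz: every positive linear map on `M₂(ℂ)` is decomposable,
i.e. a sum of a completely positive map and a completely positive map composed with
transposition. -/
theorem stormer_decomposable
    (τ : Matrix (Fin 2) (Fin 2) ℂ →ₗ[ℂ] Matrix (Fin 2) (Fin 2) ℂ)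
    (hτ : ∀ a : Matrix (Fin 2) (Fin 2) ℂ, a.PosSemidef → (τ a).PosSemidef) :
    ∃ τ₁ τ₂ : Matrix (Fin 2) (Fin 2) ℂ →ₗ[ℂ] Matrix (Fin 2) (Fin 2) ℂ,
      IsCP τ₁ ∧ IsCP τ₂ ∧ τ = τ₁ + τ₂ ∘ₗ transposeMap := by
  obtain ⟨L, hL, rfl⟩ := Stormer.exists_rep τ hτ
  have h0 := (hL _ Stormer.e0_inC).1
  set c := (L *ᵥ Stormer.e0) 0 with hc
  rcases h0.eq_or_lt with h | h
  · -- the degenerate case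
    have hzero : L = 0 := by
      ext i j
      by_contra hne
      have hne : L i j ≠ 0 := hne
      have hKL : (4 / |L i j|) • L ∈ Stormer.KL := by
        refine ⟨Stormer.pos_smul hL (by positivity), ?_⟩
        rw [smul_mulVec, Pi.smul_apply, ← hc, ← h, smul_zero]
        exact zero_le_one
      have hb := Stormer.entry_bound hKL i j
      rw [Matrix.smul_apply, smul_eq_mul, abs_mul, abs_div, abs_abs,
        div_mul_cancel₀ _ (abs_ne_zero.2 hne)] at hb
      norm_num at hb
    refine ⟨0, 0, Stormer.cp_zero, Stormer.cp_zero, ?_⟩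
    rw [hzero, Stormer.Phi_zero]
    simp
  · have hK : c⁻¹ • L ∈ Stormer.K := by
      refine ⟨Stormer.pos_smul hL (inv_nonneg.2 h.le), ?_⟩
      rw [smul_mulVec]
      exact inv_mul_cancel₀ h.ne'
    obtain ⟨A, hA, B, hB, hAB⟩ := Stormer.K_subset hK
    have hAB : A + B = c⁻¹ • L := hAB
    have hLe : L = c • A + c • B := by
      rw [← smul_add, hAB, smul_smul, mul_inv_cancel₀ h.ne', one_smul]
    refine ⟨(c : ℂ) • Stormer.Phi A, (c : ℂ) • (Stormer.Phi B ∘ₗ transposeMap),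
      Stormer.cp_smul hA.2 h.le, Stormer.cp_smul hB.2 h.le, ?_⟩
    rw [LinearMap.smul_comp, Stormer.transpose_comp, hLe, Stormer.Phi_add, Stormer.Phi_smul,
      Stormer.Phi_smul]
end
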